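/- arXiv:1803.02513 — 4 statements merged into one kernel-verified Lean document; each statement's English description precedes it below -/
import Mathlib

section
/- Let f and g be continuous functions on (0,∞) with g(t) > 0 for all t > 0, and suppose the Laplace transforms F(x) = ∫_0^∞ f(t)·e^{−xt} dt and G(x) = ∫_0^∞ g(t)·e^{−xt} dt converge for every x > 0. Suppose there exists t* ∈ (0,∞) such that f/g is strictly increasing on (0,t*) and strictly decreasing on (t*,∞), and suppose lim_{x→0⁺} ( (F′(x)/G′(x))·G(x) − F(x) ) exists and is negative. Then there exists x* > 0 such that F/G is increasing on (0,x*) and decreasing on (x*,∞). -/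
open Real Filter Set MeasureTheory Topology

theorem setIntegral_pos_of_forall_pos {s : Set ℝ} {u : ℝ → ℝ} (hs : MeasurableSet s)
    (hvol : 0 < volume s) (hu : IntegrableOn u s) (hpos : ∀ t ∈ s, 0 < u t) :
    0 < ∫ t in s, u t := by
  rw [setIntegral_pos_iff_support_of_nonneg_ae _ hu]
  · rwa [inter_eq_right.2 fun t ht => Function.mem_support.2 (hpos t ht).ne']
  · exact (ae_restrict_iff' hs).2 (Eventually.of_forall fun t ht => (hpos t ht).le)

theorem hasDerivAt_laplace {h : ℝ → ℝ}
    (hint : ∀ x > (0 : ℝ), IntegrableOn (fun t => h t * exp (-x * t)) (Ioi 0))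
    {x : ℝ} (hx : 0 < x) :
    IntegrableOn (fun t => h t * exp (-x * t) * (-t)) (Ioi 0) ∧
      HasDerivAt (fun y => ∫ t in Ioi (0 : ℝ), h t * exp (-y * t))
        (∫ t in Ioi (0 : ℝ), h t * exp (-x * t) * (-t)) x := by
  refine hasDerivAt_integral_of_dominated_loc_of_deriv_le (μ := volume.restrict (Ioi 0))
    (s := Ioi (x / 2)) (F := fun y t => h t * exp (-y * t))
    (F' := fun y t => h t * exp (-y * t) * (-t))
    (bound := fun t => 4 / x * ‖h t * exp (-(x / 4) * t)‖)
    (Ioi_mem_nhds (by linarith)) ?_ (hint x hx) ?_ ?_ ?_ ?_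
  · filter_upwards [Ioi_mem_nhds hx] with y hy using (hint y hy).aestronglyMeasurable
  · exact (hint x hx).aestronglyMeasurable.mul continuous_neg.aestronglyMeasurable
  · refine (ae_restrict_iff' measurableSet_Ioi).2 (Eventually.of_forall fun t ht y hy => ?_)
    have ht : 0 < t := ht
    have hy : x / 2 < y := hy
    have hle : t ≤ 4 / x * exp (x / 4 * t) := by
      have := add_one_le_exp (x / 4 * t)
      calc t = 4 / x * (x / 4 * t) := by field_simp
        _ ≤ _ := by gcongr; linarith
    have hexp : exp (-y * t) ≤ exp (-(x / 4) * t) * exp (-(x / 4 * t)) := by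
      rw [← exp_add, exp_le_exp]; nlinarith
    have hone : exp (-(x / 4 * t)) * exp (x / 4 * t) = 1 := by
      rw [← exp_add]; simp
    rw [norm_mul, norm_mul, norm_mul, norm_neg, norm_of_nonneg ht.le,
      norm_of_nonneg (exp_pos _).le, norm_of_nonneg (exp_pos _).le]
    calc ‖h t‖ * exp (-y * t) * t
        ≤ ‖h t‖ * (exp (-(x / 4) * t) * exp (-(x / 4 * t))) * (4 / x * exp (x / 4 * t)) := by
          gcongr
      _ = 4 / x * (‖h t‖ * exp (-(x / 4) * t)) * (exp (-(x / 4 * t)) * exp (x / 4 * t)) := by ring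
      _ = _ := by rw [hone, mul_one]
  · exact (hint (x / 4) (by linarith)).norm.const_mul _
  · refine Eventually.of_forall fun t y _ => ?_
    have h1 : HasDerivAt (fun y : ℝ => -y * t) (-t) y := by
      simpa using (hasDerivAt_id y).neg.mul_const t
    simpa [mul_assoc] using h1.exp.const_mul (h t)

/-- A function that is positive near `0` has a Laplace transform that is positive near infinity. -/
theorem exists_forall_ge_laplace_pos {h : ℝ → ℝ}
    (hint : ∀ x > (0 : ℝ), IntegrableOn (fun t => h t * exp (-x * t)) (Ioi 0))
    {τ : ℝ} (hτ : 0 < τ) (hpos : ∀ t ∈ Ioo 0 τ, 0 < h t) :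
    ∃ X > (0 : ℝ), ∀ x ≥ X, 0 < ∫ t in Ioi (0 : ℝ), h t * exp (-x * t) := by
  set k : ℝ → ℝ := fun t => h t * exp (-1 * t) with hk
  have hkint : IntegrableOn k (Ioi 0) := hint 1 one_pos
  have hsub : Ioo 0 (τ / 2) ⊆ Ioi (0 : ℝ) := fun t ht => ht.1
  have hkpos : ∀ t ∈ Ioo 0 τ, 0 < k t := fun t ht => mul_pos (hpos t ht) (exp_pos _)
  have hc : 0 < ∫ t in Ioo 0 (τ / 2), k t :=
    setIntegral_pos_of_forall_pos measurableSet_Ioo (by simp [hτ]) (hkint.mono_set hsub)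
      fun t ht => hkpos t ⟨ht.1, by linarith [ht.2]⟩
  set c := ∫ t in Ioo 0 (τ / 2), k t
  set C := ∫ t in Ioi (0 : ℝ), |k t|
  have hlim : Tendsto (fun y : ℝ => exp (y * (τ / 2)) * c) atTop atTop :=
    (tendsto_exp_atTop.comp (tendsto_id.atTop_mul_const (by linarith))).atTop_mul_const hc
  obtain ⟨Y, hY⟩ := (hlim.eventually_gt_atTop C).exists_forall_of_atTop
  refine ⟨max Y 0 + 1, by positivity, fun x hx => ?_⟩
  have hxY : Y ≤ x - 1 := by linarith [le_max_left Y 0]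
  have hx0 : 0 ≤ x - 1 := by linarith [le_max_right Y 0]
  have hind : IntegrableOn ((Ioo 0 (τ / 2)).indicator k) (Ioi 0) :=
    hkint.indicator measurableSet_Ioo
  have hle : ∫ t in Ioi (0 : ℝ), (exp ((x - 1) * (τ / 2)) * (Ioo 0 (τ / 2)).indicator k t - |k t|)
      ≤ ∫ t in Ioi (0 : ℝ), exp ((x - 1) * τ) * (h t * exp (-x * t)) := by
    refine setIntegral_mono_on ((hind.const_mul _).sub hkint.abs)
      ((hint x (by linarith)).const_mul _) measurableSet_Ioi fun t ht => ?_
    have ht : 0 < t := ht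
    have heq : exp ((x - 1) * τ) * (h t * exp (-x * t)) = exp ((x - 1) * (τ - t)) * k t := by
      have : exp ((x - 1) * τ) * exp (-x * t) = exp ((x - 1) * (τ - t)) * exp (-1 * t) := by
        rw [← exp_add, ← exp_add]; ring_nf
      rw [hk]; linear_combination h t * this
    rw [heq]
    by_cases h1 : t ∈ Ioo 0 (τ / 2)
    · rw [indicator_of_mem h1]
      have hkt := hkpos t ⟨h1.1, by linarith [h1.2]⟩
      have : exp ((x - 1) * (τ / 2)) ≤ exp ((x - 1) * (τ - t)) := by
        rw [exp_le_exp]; exact mul_le_mul_of_nonneg_left (by linarith [h1.2]) hx0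
      nlinarith [abs_nonneg (k t)]
    · rw [indicator_of_notMem h1, mul_zero, zero_sub]
      by_cases h2 : t < τ
      · have := mul_pos (exp_pos ((x - 1) * (τ - t))) (hkpos t ⟨ht, h2⟩)
        linarith [abs_nonneg (k t)]
      · have : exp ((x - 1) * (τ - t)) ≤ 1 := by
          rw [exp_le_one_iff]; nlinarith
        nlinarith [neg_abs_le (k t), abs_nonneg (k t), exp_pos ((x - 1) * (τ - t))]
  rw [integral_sub (hind.const_mul _) hkint.abs, integral_const_mul, integral_const_mul,
    setIntegral_indicator measurableSet_Ioo, inter_eq_right.2 hsub] at hle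
  have := hY (x - 1) hxY
  exact pos_of_mul_pos_right (lt_of_lt_of_le (by linarith) hle) (exp_pos _).le

theorem exists_exp_combination {p q a b : ℝ} (hp : 0 < p) (hq : 0 < q) (hab : a < b) :
    ∃ α ≥ (0 : ℝ), ∃ β ≥ (0 : ℝ),
      (∀ t ≤ a, 1 ≤ α * exp (p * t) + β * exp (-q * t)) ∧
      (∀ t ∈ Icc a b, α * exp (p * t) + β * exp (-q * t) ≤ 1) ∧
      (∀ t ≥ b, 1 ≤ α * exp (p * t) + β * exp (-q * t)) := by
  have hpab : exp (p * a) < exp (p * b) := exp_lt_exp.2 (mul_lt_mul_of_pos_left hab hp)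
  have hqab : exp (-q * b) < exp (-q * a) := exp_lt_exp.2 (by nlinarith)
  have hD : 0 < exp (p * b) * exp (-q * a) - exp (p * a) * exp (-q * b) := by
    nlinarith [exp_pos (p * a), exp_pos (-q * b)]
  set D := exp (p * b) * exp (-q * a) - exp (p * a) * exp (-q * b) with hDdef
  set α := (exp (-q * a) - exp (-q * b)) / D with hαdef
  set β := (exp (p * b) - exp (p * a)) / D with hβdef
  have hα : 0 ≤ α := div_nonneg (by linarith) hD.le
  have hβ : 0 ≤ β := div_nonneg (by linarith) hD.le
  set θ : ℝ → ℝ := fun t => α * exp (p * t) + β * exp (-q * t) with hθ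
  have hθa : θ a = 1 := by
    simp only [hθ, hαdef, hβdef]
    rw [div_mul_eq_mul_div, div_mul_eq_mul_div, ← add_div, div_eq_one_iff_eq hD.ne', hDdef]
    ring
  have hθb : θ b = 1 := by
    simp only [hθ, hαdef, hβdef]
    rw [div_mul_eq_mul_div, div_mul_eq_mul_div, ← add_div, div_eq_one_iff_eq hD.ne', hDdef]
    ring
  have hexp (c : ℝ) : ConvexOn ℝ univ fun t => exp (c * t) := by
    simpa [Function.comp_def] using convexOn_exp.comp_linearMap (LinearMap.mul ℝ ℝ c)
  have hconv : ConvexOn ℝ univ θ := ((hexp p).smul hα).add ((hexp (-q)).smul hβ)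
  refine ⟨α, hα, β, hβ, fun t ht => ?_, fun t ht => ?_, fun t ht => ?_⟩
  · change 1 ≤ θ t
    rcases ht.eq_or_lt with rfl | ht
    · exact hθa.ge
    · have := hconv.slope_mono_adjacent (mem_univ t) (mem_univ b) ht hab
      rw [hθa, hθb, sub_self, zero_div, div_nonpos_iff] at this
      rcases this with h | h <;> linarith
  · change θ t ≤ 1
    have := hconv.le_max_of_mem_Icc (mem_univ a) (mem_univ b) ht
    rwa [hθa, hθb, max_self] at this
  · change 1 ≤ θ t
    rcases ht.eq_or_lt with rfl | ht
    · exact hθb.ge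
    · have := hconv.slope_mono_adjacent (mem_univ a) (mem_univ t) hab ht
      rw [hθa, hθb, sub_self, zero_div, div_nonneg_iff] at this
      rcases this with h | h <;> linarith

/-- Variation diminishing: if `h` is positive precisely on an interval, then its Laplace transform
cannot change sign in the pattern positive, negative, positive. -/
theorem laplace_nonneg_of_ordConnected {h : ℝ → ℝ} (hcont : ContinuousOn h (Ioi 0))
    (hint : ∀ x > (0 : ℝ), IntegrableOn (fun t => h t * exp (-x * t)) (Ioi 0))
    (hconn : ∀ s t u, 0 < s → s < t → t < u → 0 < h s → 0 < h u → 0 < h t)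
    {x y z : ℝ} (hx : 0 < x) (hxy : x < y) (hyz : y < z)
    (hposx : 0 < ∫ t in Ioi (0 : ℝ), h t * exp (-x * t))
    (hposz : 0 < ∫ t in Ioi (0 : ℝ), h t * exp (-z * t)) :
    0 ≤ ∫ t in Ioi (0 : ℝ), h t * exp (-y * t) := by
  suffices hw : ∃ α ≥ (0 : ℝ), ∃ β ≥ (0 : ℝ), ∀ t > (0 : ℝ),
      0 ≤ h t * (1 - (α * exp ((y - x) * t) + β * exp (-(z - y) * t))) by
    obtain ⟨α, hα, β, hβ, hw⟩ := hw
    have hle : ∫ t in Ioi (0 : ℝ), (α * (h t * exp (-x * t)) + β * (h t * exp (-z * t)))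
        ≤ ∫ t in Ioi (0 : ℝ), h t * exp (-y * t) := by
      refine setIntegral_mono_on (((hint x hx).const_mul α).add
        ((hint z (by linarith)).const_mul β)) (hint y (by linarith)) measurableSet_Ioi
        fun t ht => ?_
      have h1 : exp (-x * t) = exp ((y - x) * t) * exp (-y * t) := by
        rw [← exp_add]; ring_nf
      have h2 : exp (-z * t) = exp (-(z - y) * t) * exp (-y * t) := by
        rw [← exp_add]; ring_nf
      rw [h1, h2]
      nlinarith [mul_nonneg (hw t ht) (exp_pos (-y * t)).le]
    rw [integral_add ((hint x hx).const_mul α) ((hint z (by linarith)).const_mul β),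
      integral_const_mul, integral_const_mul] at hle
    exact le_trans (by positivity) hle
  set A := {t : ℝ | 0 < t ∧ 0 < h t}
  have hAne : A.Nonempty := by
    by_contra hne
    refine hposx.not_ge (setIntegral_nonpos measurableSet_Ioi fun t ht => ?_)
    exact mul_nonpos_of_nonpos_of_nonneg (not_lt.1 fun hh => hne ⟨t, ht, hh⟩) (exp_pos _).le
  have hAbelow : BddBelow A := ⟨0, fun t ht => ht.1.le⟩
  have hlow : ∀ t > 0, t < sInf A → h t ≤ 0 := fun t ht hta =>
    not_lt.1 fun hh => hta.not_ge (csInf_le hAbelow ⟨ht, hh⟩)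
  by_cases hAabove : BddAbove A
  · have hab : sInf A < sSup A := by
      obtain ⟨t, ht⟩ := hAne
      have hopen : IsOpen A := hcont.isOpen_inter_preimage isOpen_Ioi isOpen_Ioi
      have hmem : A ∈ 𝓝[>] t := nhdsWithin_le_nhds (hopen.mem_nhds ht)
      obtain ⟨u, hu, htu⟩ := Filter.nonempty_of_mem (inter_mem hmem self_mem_nhdsWithin)
      exact (csInf_le hAbelow ht).trans_lt (lt_of_lt_of_le htu (le_csSup hAabove hu))
    obtain ⟨α, hα, β, hβ, h1, h2, h3⟩ :=
      exists_exp_combination (sub_pos.2 hxy) (sub_pos.2 hyz) hab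
    refine ⟨α, hα, β, hβ, fun t ht => ?_⟩
    rcases lt_trichotomy t (sInf A) with hta | hta | hta
    · exact mul_nonneg_of_nonpos_of_nonpos (hlow t ht hta) (by linarith [h1 t hta.le])
    · rw [le_antisymm (h2 t ⟨hta.ge, hta.le.trans hab.le⟩) (h1 t hta.le)]; simp
    rcases lt_trichotomy t (sSup A) with htb | htb | htb
    · obtain ⟨s, hs, hst⟩ := exists_lt_of_csInf_lt hAne hta
      obtain ⟨u, hu, htu⟩ := exists_lt_of_lt_csSup hAne htb
      exact mul_nonneg (hconn s t u hs.1 hst htu hs.2 hu.2).le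
        (by linarith [h2 t ⟨hta.le, htb.le⟩])
    · rw [le_antisymm (h2 t ⟨hta.le, htb.le⟩) (h3 t htb.ge)]; simp
    · refine mul_nonneg_of_nonpos_of_nonpos ?_ (by linarith [h3 t htb.le])
      exact not_lt.1 fun hh => htb.not_ge (le_csSup hAabove ⟨ht, hh⟩)
  · refine ⟨0, le_rfl, exp ((z - y) * sInf A), (exp_pos _).le, fun t ht => ?_⟩
    rw [zero_mul, zero_add, ← exp_add]
    rcases lt_trichotomy t (sInf A) with hta | hta | hta
    · refine mul_nonneg_of_nonpos_of_nonpos (hlow t ht hta) ?_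
      rw [sub_nonpos, one_le_exp_iff]
      nlinarith
    · rw [← hta, neg_mul, add_neg_cancel]; simp
    · obtain ⟨s, hs, hst⟩ := exists_lt_of_csInf_lt hAne hta
      obtain ⟨u, hu, htu⟩ := not_bddAbove_iff.1 hAabove t
      refine mul_nonneg (hconn s t u hs.1 hst htu hs.2 hu.2).le ?_
      rw [sub_nonneg, exp_le_one_iff]
      nlinarith

/-- A quasiconcave function that increases near `0` and is not monotone increases and then
decreases. -/
theorem exists_monotoneOn_antitoneOn_of_quasiconcave {R : ℝ → ℝ}
    (hR : ∀ x y z, 0 < x → x < y → y < z → min (R x) (R z) ≤ R y)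
    {δ : ℝ} (hδ : 0 < δ) (hmono : MonotoneOn R (Ioo 0 δ)) (hnot : ¬ MonotoneOn R (Ioi 0)) :
    ∃ m > (0 : ℝ), MonotoneOn R (Ioo 0 m) ∧ AntitoneOn R (Ioi m) := by
  set S := {m : ℝ | MonotoneOn R (Ioo 0 m)}
  have hSne : S.Nonempty := ⟨δ, hmono⟩
  have hSbdd : BddAbove S := by
    by_contra hS
    refine hnot fun u hu v hv huv => ?_
    obtain ⟨m, hm, hvm⟩ := not_bddAbove_iff.1 hS v
    exact hm ⟨hu, huv.trans_lt hvm⟩ ⟨hv, hvm⟩ huv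
  refine ⟨sSup S, hδ.trans_le (le_csSup hSbdd hmono), fun u hu v hv huv => ?_,
    fun u hu v hv huv => ?_⟩
  · obtain ⟨m, hm, hvm⟩ := exists_lt_of_lt_csSup hSne hv.2
    exact hm ⟨hu.1, huv.trans_lt hvm⟩ ⟨hv.1, hvm⟩ huv
  · have huS : ¬ MonotoneOn R (Ioo 0 u) := fun hh => (mem_Ioi.1 hu).not_ge (le_csSup hSbdd hh)
    by_contra! hlt
    refine huS fun p hp q hq hpq => ?_
    by_contra! hqp
    have hpq : p < q := hpq.lt_of_ne fun h => by simp [h] at hqp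
    have huv : u < v := huv.lt_of_ne fun h => by simp [h] at hlt
    have h1 := hR p q v hp.1 hpq (hq.2.trans huv)
    have h2 := hR q u v hq.1 hq.2 huv
    rcases min_le_iff.1 h1 with h | h <;> rcases min_le_iff.1 h2 with h' | h' <;> linarith

theorem stmt_5 (f g : ℝ → ℝ)
    (hf : ContinuousOn f (Ioi 0)) (hg : ContinuousOn g (Ioi 0))
    (hgpos : ∀ t ∈ Ioi (0 : ℝ), 0 < g t)
    (hfint : ∀ x > (0 : ℝ), IntegrableOn (fun t => f t * Real.exp (-x * t)) (Ioi 0))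
    (hgint : ∀ x > (0 : ℝ), IntegrableOn (fun t => g t * Real.exp (-x * t)) (Ioi 0))
    (F G : ℝ → ℝ)
    (hF : ∀ x, F x = ∫ t in Ioi (0 : ℝ), f t * Real.exp (-x * t))
    (hG : ∀ x, G x = ∫ t in Ioi (0 : ℝ), g t * Real.exp (-x * t))
    (tstar : ℝ) (htstar : tstar ∈ Ioi (0 : ℝ))
    (hinc : StrictMonoOn (fun t => f t / g t) (Ioo 0 tstar))
    (hdec : StrictAntiOn (fun t => f t / g t) (Ioi tstar))
    (L : ℝ) (hLneg : L < 0)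
    (hL : Tendsto (fun x => deriv F x / deriv G x * G x - F x)
      (𝓝[>] (0 : ℝ)) (𝓝 L)) :
    ∃ xstar > (0 : ℝ), MonotoneOn (fun x => F x / G x) (Ioo 0 xstar) ∧
      AntitoneOn (fun x => F x / G x) (Ioi xstar) := by
  have htstar : 0 < tstar := htstar
  have hGpos : ∀ x > 0, 0 < G x := fun x hx => by
    rw [hG]
    exact setIntegral_pos_of_forall_pos measurableSet_Ioi (by simp) (hgint x hx)
      fun t ht => mul_pos (hgpos t ht) (exp_pos _)
  have hint (c : ℝ) : ∀ x > (0 : ℝ),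
      IntegrableOn (fun t => (f t - c * g t) * exp (-x * t)) (Ioi 0) := fun x hx => by
    refine ((hfint x hx).sub ((hgint x hx).const_mul c)).congr_fun (fun t _ => ?_) measurableSet_Ioi
    simp only [Pi.sub_apply]
    ring
  have hsub (c : ℝ) : ∀ x > (0 : ℝ),
      ∫ t in Ioi (0 : ℝ), (f t - c * g t) * exp (-x * t) = F x - c * G x := fun x hx => by
    rw [hF, hG, ← integral_const_mul, ← integral_sub (hfint x hx) ((hgint x hx).const_mul c)]
    simp only [sub_mul, mul_assoc]
  have hratio (c t : ℝ) (ht : 0 < t) : 0 < f t - c * g t ↔ c < f t / g t := by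
    rw [sub_pos, lt_div_iff₀ (hgpos t ht)]
  obtain ⟨δ, hδ, hδL⟩ := mem_nhdsGT_iff_exists_Ioo_subset.1 (hL.eventually_lt_const hLneg)
  refine exists_monotoneOn_antitoneOn_of_quasiconcave ?_ hδ ?_ ?_
  · intro x y z hx hxy hyz
    by_contra! hlt
    obtain ⟨c, hyc, hc⟩ := exists_between hlt
    obtain ⟨hxc, hzc⟩ := lt_min_iff.1 hc
    rw [lt_div_iff₀ (hGpos x hx), ← sub_pos, ← hsub c x hx] at hxc
    rw [lt_div_iff₀ (hGpos z (by linarith)), ← sub_pos, ← hsub c z (by linarith)] at hzc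
    rw [div_lt_iff₀ (hGpos y (by linarith)), ← sub_neg, ← hsub c y (by linarith)] at hyc
    refine hyc.not_ge (laplace_nonneg_of_ordConnected (hf.sub (hg.const_mul c)) (hint c) ?_
      hx hxy hyz hxc hzc)
    intro s t u hs hst htu hps hpu
    change 0 < f s - c * g s at hps
    change 0 < f u - c * g u at hpu
    change 0 < f t - c * g t
    rw [hratio c s hs] at hps
    rw [hratio c u (by linarith)] at hpu
    rw [hratio c t (by linarith)]
    rcases lt_trichotomy t tstar with h | rfl | h
    · exact hps.trans (hinc ⟨hs, hst.trans h⟩ ⟨hs.trans hst, h⟩ hst)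
    · refine hps.trans_le (ge_of_tendsto (x := 𝓝[<] t) (f := fun t => f t / g t) ?_ ?_)
      · exact ((hf.div hg fun t ht => (hgpos t ht).ne').continuousAt
          (Ioi_mem_nhds htstar)).tendsto.mono_left nhdsWithin_le_nhds
      · filter_upwards [Ioo_mem_nhdsLT hst] with v hv
        exact (hinc ⟨hs, hst⟩ ⟨hs.trans hv.1, hv.2⟩ hv.1).le
    · exact hpu.trans (hdec h (h.trans htu) htu)
  · have hder : ∀ x > 0, HasDerivAt (fun x => F x / G x)
        ((deriv F x * G x - F x * deriv G x) / G x ^ 2) x := fun x hx => by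
      have hF' : DifferentiableAt ℝ F x := by
        rw [funext hF]; exact (hasDerivAt_laplace hfint hx).2.differentiableAt
      have hG' : DifferentiableAt ℝ G x := by
        rw [funext hG]; exact (hasDerivAt_laplace hgint hx).2.differentiableAt
      exact hF'.hasDerivAt.div hG'.hasDerivAt (hGpos x hx).ne'
    refine monotoneOn_of_deriv_nonneg (convex_Ioo 0 δ)
      (fun x hx => (hder x hx.1).continuousAt.continuousWithinAt)
      (fun x hx => (hder x (interior_subset hx).1).differentiableAt.differentiableWithinAt) ?_
    intro x hx
    rw [interior_Ioo] at hx
    have hG' : deriv G x < 0 := by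
      obtain ⟨hi, hd⟩ := hasDerivAt_laplace hgint hx.1
      rw [funext hG, hd.deriv, ← neg_pos, ← integral_neg]
      refine setIntegral_pos_of_forall_pos measurableSet_Ioi (by simp) hi.neg fun t ht => ?_
      rw [mul_neg, neg_neg]
      exact mul_pos (mul_pos (hgpos t ht) (exp_pos _)) ht
    have hH : deriv F x / deriv G x * G x - F x < 0 := hδL hx
    rw [(hder x hx.1).deriv]
    have heq : deriv F x * G x - F x * deriv G x =
        deriv G x * (deriv F x / deriv G x * G x - F x) := by
      field_simp [hG'.ne]
    rw [heq]
    exact div_nonneg (mul_pos_of_neg_of_neg hG' hH).le (sq_nonneg _)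
  · intro hmono
    have hle : ∀ t ∈ Ioo 0 tstar, ∀ x > 0, F x / G x ≤ f t / g t := fun t ht x hx => by
      set c := f t / g t
      obtain ⟨X, hX, hXpos⟩ := exists_forall_ge_laplace_pos (h := fun s => -(f s - c * g s))
        (fun x hx => (hint c x hx).neg.congr_fun (fun t _ => (neg_mul _ _).symm)
          measurableSet_Ioi) ht.1 fun s hs => by
          have hlt : f s / g s < c := hinc ⟨hs.1, hs.2.trans ht.2⟩ ht hs.2
          rw [div_lt_iff₀ (hgpos s hs.1)] at hlt
          linarith
      have hpos := hXpos (max X x) (le_max_left _ _)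
      have hm : 0 < max X x := lt_max_of_lt_left hX
      simp only [neg_mul _ (exp _), integral_neg] at hpos
      rw [hsub c _ hm] at hpos
      refine (hmono hx hm (le_max_right _ _)).trans ?_
      rw [div_le_iff₀ (hGpos _ hm)]
      linarith
    set r := fun t => f t / g t
    set ρ := sInf (r '' Ioo 0 tstar)
    have hbdd : BddBelow (r '' Ioo 0 tstar) :=
      ⟨F 1 / G 1, forall_mem_image.2 fun t ht => hle t ht 1 one_pos⟩
    obtain ⟨X, hX, hXpos⟩ := exists_forall_ge_laplace_pos (hint ρ) htstar fun t ht => by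
      rw [hratio ρ t ht.1]
      have hmem : t / 2 ∈ Ioo 0 tstar := ⟨by linarith [ht.1], by linarith [ht.1, ht.2]⟩
      exact (csInf_le hbdd (mem_image_of_mem r hmem)).trans_lt
        (hinc hmem ht (by linarith [ht.1]))
    have hpos := hXpos X le_rfl
    rw [hsub ρ X hX, sub_pos, ← lt_div_iff₀ (hGpos X hX)] at hpos
    exact hpos.not_ge (le_csInf ((nonempty_Ioo.2 htstar).image r)
      (forall_mem_image.2 fun t ht => hle t ht X hX))
end

section
/- The function Φ(x) = 1/(ψ(x + 1/2) − ln x) − 24x² is strictly increasing on (0,∞), with lim_{x→0⁺} Φ(x) = 0 and lim_{x→∞} Φ(x) = 21/5. In particular, 0 < Φ(x) < 21/5 for all x > 0. -/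
open Real Filter Set Topology

/-- The digamma function `ψ(x) = d/dx log Γ(x)`. -/
noncomputable def digamma (x : ℝ) : ℝ := deriv (fun y => Real.log (Real.Gamma y)) x

/-- `Φ(x) = 1/(ψ(x + 1/2) − ln x) − 24x²`. -/
noncomputable def Phi (x : ℝ) : ℝ := 1 / (digamma (x + 1 / 2) - Real.log x) - 24 * x ^ 2

lemma nonneg_of_antitoneOn_of_tendsto_zero {g : ℝ → ℝ} (hg : AntitoneOn g (Ioi 0))
    (hlim : Tendsto g atTop (𝓝 0)) {x : ℝ} (hx : 0 < x) : 0 ≤ g x := by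
  refine le_of_tendsto hlim ?_
  filter_upwards [eventually_ge_atTop x] with y hy
  exact hg hx (hx.trans_le hy) hy

lemma antitoneOn_Ioi_of_hasDerivAt_nonpos {g g' : ℝ → ℝ}
    (hg : ∀ x > 0, HasDerivAt g (g' x) x) (hg' : ∀ x > 0, g' x ≤ 0) : AntitoneOn g (Ioi 0) := by
  refine antitoneOn_of_deriv_nonpos (convex_Ioi 0)
    (fun x hx => (hg x hx).continuousAt.continuousWithinAt) ?_ ?_
  · intro x hx
    rw [interior_Ioi] at hx
    exact (hg x hx).differentiableAt.differentiableWithinAt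
  · intro x hx
    rw [interior_Ioi] at hx
    rw [(hg x hx).deriv]
    exact hg' x hx

/-- A function vanishing at infinity whose backward unit differences are antitone is antitone. -/
lemma antitoneOn_of_antitoneOn_sub_shift {g : ℝ → ℝ} (hlim : Tendsto g atTop (𝓝 0))
    (hg : AntitoneOn (fun x => g x - g (x + 1)) (Ioi 0)) : AntitoneOn g (Ioi 0) := by
  intro x hx y hy hxy
  rw [mem_Ioi] at hx hy
  have hanti : Antitone fun n : ℕ => g (x + n) - g (y + n) := by
    refine antitone_nat_of_succ_le fun n => ?_
    have hn : (0 : ℝ) ≤ n := n.cast_nonneg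
    have := hg (a := x + n) (b := y + n) (by simp only [mem_Ioi]; linarith)
      (by simp only [mem_Ioi]; linarith) (by linarith)
    simp only [add_assoc] at this
    push_cast
    linarith
  have hl : Tendsto (fun n : ℕ => g (x + n) - g (y + n)) atTop (𝓝 0) := by
    have h (c : ℝ) : Tendsto (fun n : ℕ => g (c + n)) atTop (𝓝 0) :=
      hlim.comp (tendsto_atTop_add_const_left _ c tendsto_natCast_atTop_atTop)
    simpa using (h x).sub (h y)
  have := hanti.le_of_tendsto hl 0
  simp only [Nat.cast_zero, add_zero] at this
  linarith

lemma hasDerivAt_log_Gamma {x : ℝ} (hx : 0 < x) :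
    HasDerivAt (fun y => Real.log (Real.Gamma y)) (digamma x) x := by
  have h : DifferentiableAt ℝ Real.Gamma x :=
    Real.differentiableOn_Gamma_Ioi.differentiableAt (Ioi_mem_nhds hx)
  exact (h.log (Real.Gamma_pos_of_pos hx).ne').hasDerivAt

lemma differentiableAt_digamma {x : ℝ} (hx : 0 < x) : DifferentiableAt ℝ digamma x := by
  have hopen : IsOpen {s : ℂ | 0 < s.re} := isOpen_lt continuous_const Complex.continuous_re
  have hC : DifferentiableOn ℂ Complex.Gamma {s : ℂ | 0 < s.re} := fun s hs =>
    (Complex.differentiableAt_Gamma s fun m h => by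
      have : 0 < s.re := hs
      rw [h] at this
      simp only [Complex.neg_re, Complex.natCast_re] at this
      linarith [(m.cast_nonneg : (0 : ℝ) ≤ m)]).differentiableWithinAt
  have hmem {y : ℝ} (hy : 0 < y) : {s : ℂ | 0 < s.re} ∈ 𝓝 (y : ℂ) :=
    hopen.mem_nhds (by simpa using hy)
  have hderiv {y : ℝ} (hy : 0 < y) :
      HasDerivAt Real.Gamma (deriv Complex.Gamma y).re y := by
    have := (hC.differentiableAt (hmem hy)).hasDerivAt.real_of_complex
    simpa only [Complex.Gamma_ofReal, Complex.ofReal_re] using this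
  have h2 : DifferentiableAt ℝ (fun y : ℝ => (deriv Complex.Gamma y).re) x :=
    ((hC.deriv hopen).differentiableAt (hmem hx)).hasDerivAt.real_of_complex.differentiableAt
  refine (h2.div (hderiv hx).differentiableAt (Real.Gamma_pos_of_pos hx).ne').congr_of_eventuallyEq
    ?_
  filter_upwards [Ioi_mem_nhds hx] with y hy
  exact ((hderiv hy).log (Real.Gamma_pos_of_pos hy).ne').deriv

lemma digamma_add_one {x : ℝ} (hx : 0 < x) : digamma (x + 1) = digamma x + 1 / x := by
  have h1 : HasDerivAt (fun y => Real.log (Real.Gamma (y + 1))) (digamma (x + 1)) x :=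
    (hasDerivAt_log_Gamma (by linarith : 0 < x + 1)).comp_add_const x 1
  have h2 := (hasDerivAt_log_Gamma hx).add (Real.hasDerivAt_log hx.ne')
  rw [one_div]
  refine h1.unique (h2.congr_of_eventuallyEq ?_)
  filter_upwards [Ioi_mem_nhds hx] with y hy
  rw [Pi.add_apply, Real.Gamma_add_one (ne_of_gt hy),
    Real.log_mul (ne_of_gt hy) (Real.Gamma_pos_of_pos hy).ne', add_comm]

lemma slope_log_Gamma_add_one {x : ℝ} (hx : 0 < x) :
    slope (Real.log ∘ Real.Gamma) x (x + 1) = Real.log x := by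
  rw [slope_def_field, Function.comp, Function.comp, Real.Gamma_add_one hx.ne',
    Real.log_mul hx.ne' (Real.Gamma_pos_of_pos hx).ne']
  simp

lemma digamma_le_log {x : ℝ} (hx : 0 < x) : digamma x ≤ Real.log x := by
  rw [← slope_log_Gamma_add_one hx]
  exact Real.convexOn_log_Gamma.le_slope_of_hasDerivAt hx (by simp only [mem_Ioi]; linarith)
    (by linarith) (hasDerivAt_log_Gamma hx)

lemma log_le_digamma_add_one {x : ℝ} (hx : 0 < x) : Real.log x ≤ digamma (x + 1) := by
  rw [← slope_log_Gamma_add_one hx]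
  exact Real.convexOn_log_Gamma.slope_le_of_hasDerivAt hx (by simp only [mem_Ioi]; linarith)
    (by linarith) (hasDerivAt_log_Gamma (by linarith))

/-- The gap `ψ(x + 1/2) − ln x`. -/
noncomputable def digammaGap (x : ℝ) : ℝ := digamma (x + 1 / 2) - Real.log x

lemma tendsto_digammaGap_atTop : Tendsto digammaGap atTop (𝓝 0) := by
  have hinv : Tendsto (fun x : ℝ => 1 / x) atTop (𝓝 0) := by
    simpa only [one_div] using tendsto_inv_atTop_zero (𝕜 := ℝ)
  have hneg : Tendsto (fun x : ℝ => -(1 / x)) atTop (𝓝 0) := by simpa using hinv.neg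
  refine tendsto_of_tendsto_of_tendsto_of_le_of_le' hneg hinv ?_ ?_
  · filter_upwards [eventually_gt_atTop 0] with x hx
    have h1 := log_le_digamma_add_one (by linarith : 0 < x + 1 / 2)
    rw [digamma_add_one (by linarith)] at h1
    have h2 : Real.log x ≤ Real.log (x + 1 / 2) := Real.log_le_log hx (by linarith)
    have h3 : 1 / (x + 1 / 2) ≤ 1 / x := one_div_le_one_div_of_le hx (by linarith)
    simp only [digammaGap]
    linarith
  · filter_upwards [eventually_gt_atTop 0] with x hx
    have h1 := digamma_le_log (by linarith : 0 < x + 1 / 2)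
    have h2 := Real.log_le_sub_one_of_pos (by positivity : 0 < (x + 1 / 2) / x)
    rw [Real.log_div (by positivity) hx.ne'] at h2
    have h3 : (x + 1 / 2) / x - 1 ≤ 1 / x := by
      rw [div_sub_one hx.ne']
      gcongr
      linarith
    simp only [digammaGap]
    linarith

/-- The increment `digammaGap x − digammaGap (x + 1)`. -/
noncomputable def digammaGapStep (x : ℝ) : ℝ := Real.log (x + 1) - Real.log x - (x + 1 / 2)⁻¹

lemma digammaGap_sub_shift {x : ℝ} (hx : 0 < x) :
    digammaGap x - digammaGap (x + 1) = digammaGapStep x := by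
  have h := digamma_add_one (by linarith : 0 < x + 1 / 2)
  rw [digammaGap, digammaGap, digammaGapStep, add_right_comm, h]
  ring

lemma hasDerivAt_digammaGapStep {x : ℝ} (hx : 0 < x) :
    HasDerivAt digammaGapStep (-(1 / (x * (x + 1) * (2 * x + 1) ^ 2))) x := by
  have h1 := ((hasDerivAt_id x).add_const 1).log (by simp; positivity)
  have h2 := Real.hasDerivAt_log hx.ne'
  have h3 := ((hasDerivAt_id x).add_const (1 / 2)).inv (by simp; positivity)
  have h := (h1.sub h2).sub h3
  simp only [id] at h
  refine HasDerivAt.congr_deriv h ?_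
  field_simp
  ring

lemma differentiableAt_digammaGap {x : ℝ} (hx : 0 < x) : DifferentiableAt ℝ digammaGap x := by
  refine DifferentiableAt.sub ?_ (Real.differentiableAt_log hx.ne')
  exact differentiableAt_comp_add_const.2 (differentiableAt_digamma (by linarith))

/-- The expansion of `digammaGap` at infinity up to order `x⁻⁶`, an upper bound. -/
noncomputable def gapUpper (x : ℝ) : ℝ := 1 / 24 / x ^ 2 - 7 / 960 / x ^ 4 + 31 / 8064 / x ^ 6

/-- The expansion of `digammaGap` at infinity up to order `x⁻⁸`, a lower bound. -/
noncomputable def gapLower (x : ℝ) : ℝ := gapUpper x - 127 / 30720 / x ^ 8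

lemma hasDerivAt_const_div_pow (c : ℝ) (n : ℕ) {x : ℝ} (hx : x ≠ 0) :
    HasDerivAt (fun y => c / y ^ n) (-(n * c) / x ^ (n + 1)) x := by
  have h := ((hasDerivAt_pow n x).inv (pow_ne_zero n hx)).const_mul c
  refine HasDerivAt.congr_deriv h ?_
  rcases n with _ | n
  · simp
  · simp only [Nat.add_sub_cancel]
    field_simp
    ring

lemma hasDerivAt_gapUpper {x : ℝ} (hx : 0 < x) : HasDerivAt gapUpper
    (-(1 / 12) / x ^ 3 + 7 / 240 / x ^ 5 - 31 / 1344 / x ^ 7) x := by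
  refine (((hasDerivAt_const_div_pow (1 / 24) 2 hx.ne').sub
    (hasDerivAt_const_div_pow (7 / 960) 4 hx.ne')).add
    (hasDerivAt_const_div_pow (31 / 8064) 6 hx.ne')).congr_deriv ?_
  push_cast
  ring

lemma hasDerivAt_gapLower {x : ℝ} (hx : 0 < x) : HasDerivAt gapLower
    (-(1 / 12) / x ^ 3 + 7 / 240 / x ^ 5 - 31 / 1344 / x ^ 7 + 127 / 3840 / x ^ 9) x := by
  refine ((hasDerivAt_gapUpper hx).sub
    (hasDerivAt_const_div_pow (127 / 30720) 8 hx.ne')).congr_deriv ?_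
  push_cast
  ring

lemma tendsto_gapUpper_atTop : Tendsto gapUpper atTop (𝓝 0) := by
  have h (c : ℝ) {n : ℕ} (hn : n ≠ 0) : Tendsto (fun x : ℝ => c / x ^ n) atTop (𝓝 0) :=
    tendsto_const_nhds.div_atTop (tendsto_pow_atTop hn)
  have h' := ((h (1 / 24) two_ne_zero).sub (h (7 / 960) four_ne_zero)).add
    (h (31 / 8064) (n := 6) (by norm_num))
  rw [sub_zero, add_zero] at h'
  exact h'

lemma tendsto_gapLower_atTop : Tendsto gapLower atTop (𝓝 0) := by
  have h : Tendsto (fun x : ℝ => 127 / 30720 / x ^ 8) atTop (𝓝 0) :=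
    tendsto_const_nhds.div_atTop (tendsto_pow_atTop (by norm_num))
  have h' := tendsto_gapUpper_atTop.sub h
  rw [sub_zero] at h'
  exact h'

lemma antitoneOn_gapUpper_sub_digammaGap :
    AntitoneOn (fun x => gapUpper x - digammaGap x) (Ioi 0) := by
  refine antitoneOn_of_antitoneOn_sub_shift
    (by simpa using tendsto_gapUpper_atTop.sub tendsto_digammaGap_atTop) ?_
  have h : AntitoneOn (fun x => gapUpper x - gapUpper (x + 1) - digammaGapStep x) (Ioi 0) := by
    refine antitoneOn_Ioi_of_hasDerivAt_nonpos (fun x hx => ((hasDerivAt_gapUpper hx).sub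
      ((hasDerivAt_gapUpper (by linarith : 0 < x + 1)).comp_add_const x 1)).sub
      (hasDerivAt_digammaGapStep hx)) fun x hx => ?_
    rw [← neg_nonneg]
    field_simp
    ring_nf
    positivity
  refine h.congr fun x hx => ?_
  simp only [← digammaGap_sub_shift hx]
  ring

lemma antitoneOn_digammaGap_sub_gapLower :
    AntitoneOn (fun x => digammaGap x - gapLower x) (Ioi 0) := by
  refine antitoneOn_of_antitoneOn_sub_shift
    (by simpa using tendsto_digammaGap_atTop.sub tendsto_gapLower_atTop) ?_
  have h : AntitoneOn (fun x => digammaGapStep x - (gapLower x - gapLower (x + 1))) (Ioi 0) := by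
    refine antitoneOn_Ioi_of_hasDerivAt_nonpos (fun x hx => (hasDerivAt_digammaGapStep hx).sub
      ((hasDerivAt_gapLower hx).sub
      ((hasDerivAt_gapLower (by linarith : 0 < x + 1)).comp_add_const x 1))) fun x hx => ?_
    rw [← neg_nonneg]
    field_simp
    ring_nf
    positivity
  refine h.congr fun x hx => ?_
  simp only [← digammaGap_sub_shift hx]
  ring

lemma digammaGap_le_gapUpper {x : ℝ} (hx : 0 < x) : digammaGap x ≤ gapUpper x :=
  sub_nonneg.1 <| nonneg_of_antitoneOn_of_tendsto_zero antitoneOn_gapUpper_sub_digammaGap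
    (by simpa using tendsto_gapUpper_atTop.sub tendsto_digammaGap_atTop) hx

lemma gapLower_le_digammaGap {x : ℝ} (hx : 0 < x) : gapLower x ≤ digammaGap x :=
  sub_nonneg.1 <| nonneg_of_antitoneOn_of_tendsto_zero antitoneOn_digammaGap_sub_gapLower
    (by simpa using tendsto_digammaGap_atTop.sub tendsto_gapLower_atTop) hx

lemma deriv_digammaGap_le {x : ℝ} (hx : 0 < x) : deriv digammaGap x ≤
    -(1 / 12) / x ^ 3 + 7 / 240 / x ^ 5 - 31 / 1344 / x ^ 7 + 127 / 3840 / x ^ 9 := by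
  have hd : HasDerivAt (fun y => digammaGap y - gapLower y) _ x :=
    (differentiableAt_digammaGap hx).hasDerivAt.sub (hasDerivAt_gapLower hx)
  have h := antitoneOn_digammaGap_sub_gapLower.derivWithin_nonpos (x := x)
  rw [hd.hasDerivWithinAt.derivWithin (uniqueDiffOn_Ioi 0 x hx)] at h
  linarith

lemma deriv_digammaGap_eq {x : ℝ} (hx : 0 < x) : deriv digammaGap x =
    deriv digammaGap (x + 1) - 1 / (x * (x + 1) * (2 * x + 1) ^ 2) := by
  have h1 := (differentiableAt_digammaGap (by linarith : 0 < x + 1)).hasDerivAt.comp_add_const x 1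
  rw [sub_eq_add_neg]
  refine ((h1.add (hasDerivAt_digammaGapStep hx)).congr_of_eventuallyEq ?_).deriv
  filter_upwards [Ioi_mem_nhds hx] with y hy
  simp only [Pi.add_apply, ← digammaGap_sub_shift hy]
  ring

lemma digammaGapStep_le {x : ℝ} (hx : 0 < x) : digammaGapStep x ≤
    2 / 3 / (2 * x + 1) ^ 3 + (10 * x * (x + 1) * (2 * x + 1) ^ 3)⁻¹ := by
  have hlin {y : ℝ} : HasDerivAt (fun y : ℝ => 2 * y + 1) 2 y := by
    simpa using ((hasDerivAt_id y).const_mul 2).add_const 1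
  have hderiv {y : ℝ} (hy : 0 < y) := (((hasDerivAt_const_div_pow (2 / 3) 3
    (by positivity : 2 * y + 1 ≠ 0)).comp y hlin).add
    (((((hasDerivAt_id y).const_mul 10).mul ((hasDerivAt_id y).add_const 1)).mul
      (hlin.pow 3)).inv
      (show 10 * y * (y + 1) * (2 * y + 1) ^ 3 ≠ 0 by positivity))).sub
    (hasDerivAt_digammaGapStep hy)
  have hanti := antitoneOn_Ioi_of_hasDerivAt_nonpos (fun y hy => hderiv hy) fun y hy => by
    simp only [id, Pi.mul_apply, Pi.pow_apply]
    rw [← neg_nonneg]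
    field_simp
    ring_nf
    positivity
  have hlin_lim : Tendsto (fun y : ℝ => 2 * y + 1) atTop atTop :=
    tendsto_atTop_add_const_right _ _ (tendsto_id.const_mul_atTop two_pos)
  have hcube : Tendsto (fun y : ℝ => (2 * y + 1) ^ 3) atTop atTop :=
    (tendsto_pow_atTop three_ne_zero).comp hlin_lim
  have hstep : Tendsto digammaGapStep atTop (𝓝 0) := by
    have h := tendsto_digammaGap_atTop.sub
      (tendsto_digammaGap_atTop.comp (tendsto_atTop_add_const_right _ 1 tendsto_id))
    rw [sub_zero] at h
    refine h.congr' ?_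
    filter_upwards [eventually_gt_atTop 0] with y hy
    exact digammaGap_sub_shift hy
  have hden : Tendsto (fun y : ℝ => 10 * y * (y + 1) * (2 * y + 1) ^ 3) atTop atTop :=
    ((tendsto_id.const_mul_atTop (by norm_num : (0 : ℝ) < 10)).atTop_mul_atTop₀
      (tendsto_atTop_add_const_right _ 1 tendsto_id)).atTop_mul_atTop₀ hcube
  have hlim := (((tendsto_const_nhds (x := (2 / 3 : ℝ))).div_atTop hcube).add
    hden.inv_tendsto_atTop).sub hstep
  simp only [add_zero, sub_zero] at hlim
  exact sub_nonneg.1 (nonneg_of_antitoneOn_of_tendsto_zero hanti hlim hx)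

lemma digammaGap_nonneg {x : ℝ} (hx : 0 < x) : 0 ≤ digammaGap x := by
  refine nonneg_of_antitoneOn_of_tendsto_zero (antitoneOn_of_antitoneOn_sub_shift
    tendsto_digammaGap_atTop ?_) tendsto_digammaGap_atTop hx
  refine (antitoneOn_Ioi_of_hasDerivAt_nonpos (fun y hy => hasDerivAt_digammaGapStep hy)
    fun y hy => ?_).congr fun y hy => (digammaGap_sub_shift hy).symm
  rw [neg_nonpos]
  positivity

lemma deriv_digammaGap_lt {x : ℝ} (hx : 0 < x) :
    deriv digammaGap x < -(48 * x * digammaGap x ^ 2) := by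
  have h1 := deriv_digammaGap_le (by linarith : 0 < x + 1)
  have h2 : digammaGap x ≤ gapUpper (x + 1) +
      (2 / 3 / (2 * x + 1) ^ 3 + (10 * x * (x + 1) * (2 * x + 1) ^ 3)⁻¹) := by
    linarith [digammaGap_le_gapUpper (by linarith : 0 < x + 1), digammaGapStep_le hx,
      digammaGap_sub_shift hx]
  have h3 := mul_le_mul_of_nonneg_left (pow_le_pow_left₀ (digammaGap_nonneg hx) h2 2)
    (by positivity : 0 ≤ 48 * x)
  refine lt_of_lt_of_le ?_ (neg_le_neg h3)
  rw [deriv_digammaGap_eq hx, sub_lt_iff_lt_add]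
  refine h1.trans_lt ?_
  rw [gapUpper, ← sub_pos]
  field_simp
  ring_nf
  positivity

lemma digammaGap_pos {x : ℝ} (hx : 0 < x) : 0 < digammaGap x := by
  have h : StrictAntiOn digammaGap (Ioi 0) := by
    refine strictAntiOn_of_deriv_neg (convex_Ioi 0)
      (fun y hy => (differentiableAt_digammaGap hy).continuousAt.continuousWithinAt) fun y hy => ?_
    rw [interior_Ioi, mem_Ioi] at hy
    refine (deriv_digammaGap_lt hy).trans_le ?_
    rw [neg_nonpos]
    positivity
  have hx1 : 0 < x + 1 := by linarith
  exact (digammaGap_nonneg hx1).trans_lt (h hx hx1 (by linarith))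

lemma strictMonoOn_Phi : StrictMonoOn Phi (Ioi 0) := by
  have hderiv {x : ℝ} (hx : 0 < x) : HasDerivAt Phi
      (-deriv digammaGap x / digammaGap x ^ 2 - 48 * x) x := by
    have h := ((differentiableAt_digammaGap hx).hasDerivAt.inv (digammaGap_pos hx).ne').sub
      ((hasDerivAt_pow 2 x).const_mul 24)
    refine (h.congr_deriv ?_).congr_of_eventuallyEq (Eventually.of_forall fun y => ?_)
    · push_cast
      ring
    · simp [Phi, digammaGap]
  refine strictMonoOn_of_deriv_pos (convex_Ioi 0)
    (fun x hx => (hderiv hx).continuousAt.continuousWithinAt) fun x hx => ?_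
  rw [interior_Ioi, mem_Ioi] at hx
  rw [(hderiv hx).deriv, sub_pos, lt_div_iff₀ (pow_pos (digammaGap_pos hx) 2)]
  linarith [deriv_digammaGap_lt hx]

lemma tendsto_Phi_nhdsGT_zero : Tendsto Phi (𝓝[>] 0) (𝓝 0) := by
  have hdig : Tendsto (fun x : ℝ => digamma (x + 1 / 2)) (𝓝[>] 0) (𝓝 (digamma (0 + 1 / 2))) :=
    ((differentiableAt_comp_add_const.2
      (differentiableAt_digamma (by norm_num))).continuousAt.tendsto).mono_left nhdsWithin_le_nhds
  have hgap : Tendsto digammaGap (𝓝[>] 0) atTop :=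
    hdig.add_atTop (tendsto_neg_atBot_atTop.comp Real.tendsto_log_nhdsGT_zero)
  have hsq : Tendsto (fun x : ℝ => 24 * x ^ 2) (𝓝[>] 0) (𝓝 (24 * 0 ^ 2)) :=
    (Continuous.tendsto (by fun_prop) 0).mono_left nhdsWithin_le_nhds
  have h := hgap.inv_tendsto_atTop.sub hsq
  norm_num at h
  refine h.congr fun x => ?_
  simp [Phi, digammaGap]

lemma tendsto_Phi_atTop : Tendsto Phi atTop (𝓝 (21 / 5)) := by
  have hs : Tendsto (fun x : ℝ => (x ^ 2)⁻¹) atTop (𝓝 0) :=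
    (tendsto_pow_atTop two_ne_zero).inv_tendsto_atTop
  have heq (c : ℝ) {x : ℝ} (hx : 0 < x) : gapUpper x - c / x ^ 8 = (1 / 24 -
      7 / 960 * (x ^ 2)⁻¹ + 31 / 8064 * (x ^ 2)⁻¹ ^ 2 - c * (x ^ 2)⁻¹ ^ 3) / x ^ 2 := by
    rw [gapUpper]
    field_simp
  have hden (c : ℝ) : ∀ᶠ x : ℝ in atTop,
      0 < 1 / 24 - 7 / 960 * (x ^ 2)⁻¹ + 31 / 8064 * (x ^ 2)⁻¹ ^ 2 - c * (x ^ 2)⁻¹ ^ 3 := by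
    have hcont : ContinuousAt (fun s : ℝ =>
      1 / 24 - 7 / 960 * s + 31 / 8064 * s ^ 2 - c * s ^ 3) 0 := by fun_prop
    exact (hcont.tendsto.comp hs).eventually_const_lt (by norm_num)
  have hlim (c : ℝ) : Tendsto (fun x : ℝ =>
      1 / (gapUpper x - c / x ^ 8) - 24 * x ^ 2) atTop (𝓝 (21 / 5)) := by
    have hcont : ContinuousAt (fun s : ℝ =>
        (7 / 960 - 31 / 8064 * s + c * s ^ 2) * 24 /
          (1 / 24 - 7 / 960 * s + 31 / 8064 * s ^ 2 - c * s ^ 3)) 0 :=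
      ContinuousAt.div (by fun_prop) (by fun_prop) (by norm_num)
    have h := hcont.tendsto.comp hs
    have hval : (7 / 960 - 31 / 8064 * 0 + c * 0 ^ 2) * 24 /
        (1 / 24 - 7 / 960 * 0 + 31 / 8064 * 0 ^ 2 - c * 0 ^ 3) = (21 / 5 : ℝ) := by norm_num
    rw [hval] at h
    refine h.congr' ?_
    filter_upwards [hden c, eventually_gt_atTop 0] with x hx hx0
    rw [heq c hx0, Function.comp, one_div_div, eq_sub_iff_add_eq, div_add' _ _ _ hx.ne']
    congr 1
    field_simp
    ring
  have hupper := hlim 0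
  simp only [zero_div, sub_zero] at hupper
  refine tendsto_of_tendsto_of_tendsto_of_le_of_le' hupper (hlim (127 / 30720)) ?_ ?_
  · filter_upwards [eventually_gt_atTop 0] with x hx
    exact sub_le_sub_right
      (one_div_le_one_div_of_le (digammaGap_pos hx) (digammaGap_le_gapUpper hx)) _
  · filter_upwards [hden (127 / 30720), eventually_gt_atTop 0] with x hx hx0
    have hpos : 0 < gapLower x := by
      rw [gapLower, heq _ hx0]
      positivity
    exact sub_le_sub_right (one_div_le_one_div_of_le hpos (gapLower_le_digammaGap hx0)) _

theorem stmt_9 :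
    StrictMonoOn Phi (Ioi 0) ∧
    Tendsto Phi (𝓝[>] (0 : ℝ)) (𝓝 0) ∧
    Tendsto Phi atTop (𝓝 (21 / 5)) ∧
    ∀ x > (0 : ℝ), 0 < Phi x ∧ Phi x < 21 / 5 := by
  refine ⟨strictMonoOn_Phi, tendsto_Phi_nhdsGT_zero, tendsto_Phi_atTop, fun x hx => ⟨?_, ?_⟩⟩
  · have hx2 : 0 < x / 2 := half_pos hx
    refine lt_of_le_of_lt ?_ (strictMonoOn_Phi hx2 hx (half_lt_self hx))
    refine le_of_tendsto tendsto_Phi_nhdsGT_zero ?_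
    filter_upwards [Ioo_mem_nhdsGT hx2] with y hy
    exact (strictMonoOn_Phi hy.1 hx2 hy.2).le
  · have hx1 : 0 < x + 1 := by linarith
    refine (strictMonoOn_Phi hx hx1 (by linarith)).trans_le ?_
    refine ge_of_tendsto tendsto_Phi_atTop ?_
    filter_upwards [eventually_ge_atTop (x + 1)] with y hy
    exact strictMonoOn_Phi.monotoneOn hx1 (hx1.trans_le hy) hy
end

section
/- Let v ∈ (0,1), let K_v(x) = ∫_0^∞ e^{−x·cosh t}·cosh(vt) dt for x > 0, and set F(x) = x·(K_v(x) + K_v′(x)) and G(x) = K_v(x), where K_v′ denotes the derivative of K_v. Then lim_{x→0⁺} ( (F′(x)/G′(x))·G(x) − F(x) ) = 0. -/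
open Real Filter Set MeasureTheory Topology

/-- The modified Bessel function of the second kind, by its integral representation. -/
noncomputable def besselK (v x : ℝ) : ℝ :=
  ∫ t in Ioi (0 : ℝ), Real.exp (-x * Real.cosh t) * Real.cosh (v * t)

lemma cosh_le_exp_abs (y : ℝ) : Real.cosh y ≤ Real.exp |y| := by
  rw [← Real.cosh_abs, Real.cosh_eq]
  have : Real.exp (-|y|) ≤ Real.exp |y| :=
    Real.exp_le_exp.2 (by linarith [abs_nonneg y])
  linarith

lemma abs_sinh_le_exp_abs (y : ℝ) : |Real.sinh y| ≤ Real.exp |y| := by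
  refine le_trans ?_ (cosh_le_exp_abs y)
  rw [abs_le]
  constructor
  · linarith [Real.cosh_add_sinh y, Real.exp_pos y]
  · exact (Real.sinh_lt_cosh y).le

lemma exp_neg_mul_cosh_mul_exp_le {x : ℝ} (hx : 0 < x) (a : ℝ) {t : ℝ} (ht : 0 ≤ t) :
    Real.exp (-x * Real.cosh t) * Real.exp (a * t) ≤
      Real.exp ((a + 1) ^ 2 / x) * Real.exp (-t) := by
  rw [← Real.exp_add, ← Real.exp_add]
  apply Real.exp_le_exp.2
  have h1 : t ^ 2 / 4 ≤ Real.cosh t := by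
    rw [Real.cosh_eq]
    linarith [Real.quadratic_le_exp_of_nonneg ht, Real.exp_pos (-t)]
  have h2 : x * (t ^ 2 / 4) ≤ x * Real.cosh t := mul_le_mul_of_nonneg_left h1 hx.le
  have h3 : (a + 1) ^ 2 / x - (a + 1) * t + x * (t ^ 2 / 4) = ((a + 1) - x * t / 2) ^ 2 / x := by
    field_simp
    ring
  have h4 : 0 ≤ ((a + 1) - x * t / 2) ^ 2 / x := by positivity
  linarith

lemma norm_exp_neg_mul_cosh_mul_le {x : ℝ} (hx : 0 < x) {a : ℝ} {f : ℝ → ℝ}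
    (hf : ∀ t, 0 ≤ t → |f t| ≤ Real.exp (a * t)) {t : ℝ} (ht : 0 ≤ t) :
    ‖Real.exp (-x * Real.cosh t) * f t‖ ≤ Real.exp ((a + 1) ^ 2 / x) * Real.exp (-t) := by
  rw [norm_mul, Real.norm_eq_abs, Real.norm_eq_abs, Real.abs_exp]
  exact (mul_le_mul_of_nonneg_left (hf t ht) (Real.exp_pos _).le).trans
    (exp_neg_mul_cosh_mul_exp_le hx a ht)

lemma integrableOn_exp_neg_mul_cosh_mul {x : ℝ} (hx : 0 < x) {a : ℝ} {f : ℝ → ℝ}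
    (hfc : Continuous f) (hf : ∀ t, 0 ≤ t → |f t| ≤ Real.exp (a * t)) :
    IntegrableOn (fun t => Real.exp (-x * Real.cosh t) * f t) (Ioi 0) := by
  have hc : Continuous fun t => Real.exp (-x * Real.cosh t) * f t := by fun_prop
  refine ((integrableOn_exp_neg_Ioi 0).const_mul (Real.exp ((a + 1) ^ 2 / x))).mono'
    hc.aestronglyMeasurable ?_
  filter_upwards [ae_restrict_mem measurableSet_Ioi] with t ht
  exact norm_exp_neg_mul_cosh_mul_le hx hf (le_of_lt ht)

lemma tendsto_exp_neg_mul_cosh_mul {x : ℝ} (hx : 0 < x) {a : ℝ} {f : ℝ → ℝ}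
    (hf : ∀ t, 0 ≤ t → |f t| ≤ Real.exp (a * t)) :
    Tendsto (fun t => Real.exp (-x * Real.cosh t) * f t) atTop (𝓝 0) := by
  refine squeeze_zero_norm' (a := fun t => Real.exp ((a + 1) ^ 2 / x) * Real.exp (-t)) ?_ ?_
  · filter_upwards [eventually_ge_atTop 0] with t ht
    exact norm_exp_neg_mul_cosh_mul_le hx hf ht
  · simpa using Real.tendsto_exp_neg_atTop_nhds_zero.const_mul (Real.exp ((a + 1) ^ 2 / x))

lemma abs_cosh_mul_le (v : ℝ) {t : ℝ} (ht : 0 ≤ t) :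
    |Real.cosh (v * t)| ≤ Real.exp (|v| * t) := by
  rw [abs_of_pos (Real.cosh_pos _)]
  simpa [abs_mul, abs_of_nonneg ht] using cosh_le_exp_abs (v * t)

lemma abs_sinh_mul_le (v : ℝ) {t : ℝ} (ht : 0 ≤ t) :
    |Real.sinh (v * t)| ≤ Real.exp (|v| * t) := by
  simpa [abs_mul, abs_of_nonneg ht] using abs_sinh_le_exp_abs (v * t)

lemma abs_cosh_mul_cosh_le (v : ℝ) {t : ℝ} (ht : 0 ≤ t) :
    |Real.cosh t * Real.cosh (v * t)| ≤ Real.exp ((1 + |v|) * t) := by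
  rw [abs_mul, add_mul, Real.exp_add]
  have h := abs_cosh_mul_le 1 ht
  simp only [one_mul, abs_one] at h ⊢
  exact mul_le_mul h (abs_cosh_mul_le v ht) (abs_nonneg _) (Real.exp_pos _).le

lemma abs_sinh_mul_sinh_le (v : ℝ) {t : ℝ} (ht : 0 ≤ t) :
    |Real.sinh t * Real.sinh (v * t)| ≤ Real.exp ((1 + |v|) * t) := by
  rw [abs_mul, add_mul, Real.exp_add]
  have h := abs_sinh_mul_le 1 ht
  simp only [one_mul, abs_one] at h ⊢
  exact mul_le_mul h (abs_sinh_mul_le v ht) (abs_nonneg _) (Real.exp_pos _).le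

lemma integrableOn_besselK (v : ℝ) {x : ℝ} (hx : 0 < x) :
    IntegrableOn (fun t => Real.exp (-x * Real.cosh t) * Real.cosh (v * t)) (Ioi 0) :=
  integrableOn_exp_neg_mul_cosh_mul hx (by fun_prop) fun _ => abs_cosh_mul_le v

lemma besselK_pos (v : ℝ) {x : ℝ} (hx : 0 < x) : 0 < besselK v x := by
  have hpos : ∀ t, 0 < Real.exp (-x * Real.cosh t) * Real.cosh (v * t) := fun t =>
    mul_pos (Real.exp_pos _) (Real.cosh_pos _)
  refine (integral_pos_iff_support_of_nonneg (fun t => (hpos t).le)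
    (integrableOn_besselK v hx)).2 ?_
  have : Function.support (fun t => Real.exp (-x * Real.cosh t) * Real.cosh (v * t)) = univ :=
    Set.eq_univ_of_forall fun t => (hpos t).ne'
  rw [this]
  simp

lemma integral_sinh_mul_sinh (v : ℝ) {x : ℝ} (hx : 0 < x) :
    ∫ t in Ioi (0 : ℝ), Real.exp (-x * Real.cosh t) * (Real.sinh t * Real.sinh (v * t)) =
      v / x * besselK v x := by
  have hS : IntegrableOn
      (fun t => Real.exp (-x * Real.cosh t) * (Real.sinh t * Real.sinh (v * t))) (Ioi 0) :=
    integrableOn_exp_neg_mul_cosh_mul hx (by fun_prop) fun _ => abs_sinh_mul_sinh_le v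
  have hC := integrableOn_besselK v hx
  have hderiv : ∀ t : ℝ, HasDerivAt (fun t => Real.exp (-x * Real.cosh t) * Real.sinh (v * t))
      (v * (Real.exp (-x * Real.cosh t) * Real.cosh (v * t)) -
        x * (Real.exp (-x * Real.cosh t) * (Real.sinh t * Real.sinh (v * t)))) t := by
    intro t
    have h1 := ((Real.hasDerivAt_cosh t).const_mul (-x)).exp
    have h2 := ((hasDerivAt_id t).const_mul v).sinh
    refine (h1.mul h2).congr_deriv ?_
    simp only [id]
    ring
  have key := integral_Ioi_of_hasDerivAt_of_tendsto' (a := 0) (fun t _ => hderiv t)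
    ((hC.const_mul v).sub (hS.const_mul x))
    (tendsto_exp_neg_mul_cosh_mul hx fun _ => abs_sinh_mul_le v)
  rw [integral_sub (hC.const_mul v) (hS.const_mul x), integral_const_mul,
    integral_const_mul] at key
  simp only [mul_zero, Real.sinh_zero, sub_zero] at key
  rw [div_mul_eq_mul_div, eq_div_iff hx.ne', besselK]
  linarith

lemma hasDerivAt_besselK_integral (v : ℝ) {x : ℝ} (hx : 0 < x) :
    HasDerivAt (besselK v)
      (∫ t in Ioi (0 : ℝ), -(Real.exp (-x * Real.cosh t) * (Real.cosh t * Real.cosh (v * t))))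
      x := by
  have hcont : ∀ y : ℝ, Continuous fun t => Real.exp (-y * Real.cosh t) * Real.cosh (v * t) :=
    fun y => by fun_prop
  have hcont' : Continuous fun t =>
      -(Real.exp (-x * Real.cosh t) * (Real.cosh t * Real.cosh (v * t))) := by fun_prop
  refine (hasDerivAt_integral_of_dominated_loc_of_deriv_le (Ioi_mem_nhds (half_lt_self hx))
    (bound := fun t => Real.exp (-(x / 2) * Real.cosh t) * (Real.cosh t * Real.cosh (v * t)))
    (F' := fun y t => -(Real.exp (-y * Real.cosh t) * (Real.cosh t * Real.cosh (v * t))))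
    (Eventually.of_forall fun y => (hcont y).aestronglyMeasurable)
    (integrableOn_besselK v hx) hcont'.aestronglyMeasurable ?_ ?_ ?_).2
  · refine Eventually.of_forall fun t y hy => ?_
    have hc := Real.cosh_pos t
    have hcv := Real.cosh_pos (v * t)
    rw [norm_neg, Real.norm_eq_abs, abs_of_pos (by positivity)]
    have hy' : x / 2 < y := hy
    gcongr
  · exact integrableOn_exp_neg_mul_cosh_mul (half_pos hx) (by fun_prop)
      fun _ => abs_cosh_mul_cosh_le v
  · refine Eventually.of_forall fun t y _ => ?_
    have h := (((hasDerivAt_id y).neg.mul_const (Real.cosh t)).exp).mul_const (Real.cosh (v * t))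
    refine h.congr_deriv ?_
    simp only [id, Pi.neg_apply]
    ring

/-- The recurrence `K_v' = -K_{1-v} - (v / x) K_v`. -/
lemma hasDerivAt_besselK (v : ℝ) {x : ℝ} (hx : 0 < x) :
    HasDerivAt (besselK v) (-besselK (1 - v) x - v / x * besselK v x) x := by
  refine (hasDerivAt_besselK_integral v hx).congr_deriv ?_
  rw [← integral_sinh_mul_sinh v hx, besselK, ← integral_neg, ← integral_sub]
  · refine integral_congr_ae (Eventually.of_forall fun t => ?_)
    simp only [sub_mul, one_mul, Real.cosh_sub]
    ring
  · exact (integrableOn_besselK (1 - v) hx).neg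
  · exact integrableOn_exp_neg_mul_cosh_mul hx (by fun_prop) fun _ => abs_sinh_mul_sinh_le v

lemma tendsto_mul_besselK {v : ℝ} (h0 : 0 < v) (h1 : v < 1) :
    Tendsto (fun x => x * besselK v x) (𝓝[>] 0) (𝓝 0) := by
  have hlim : ∀ t : ℝ, Tendsto
      (fun x => x * (Real.exp (-x * Real.cosh t) * Real.cosh (v * t))) (𝓝[>] 0) (𝓝 0) := by
    intro t
    have hc : Continuous fun x => x * (Real.exp (-x * Real.cosh t) * Real.cosh (v * t)) := by
      fun_prop
    simpa using (hc.tendsto 0).mono_left nhdsWithin_le_nhds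
  have hbound : Integrable (fun t => 2 * Real.exp ((v - 1) * t)) (volume.restrict (Ioi 0)) :=
    (integrableOn_exp_mul_Ioi (by linarith) 0).const_mul 2
  have key := tendsto_integral_filter_of_dominated_convergence (l := 𝓝[>] (0 : ℝ)) _
    (Eventually.of_forall fun x => Continuous.aestronglyMeasurable (by fun_prop)) ?_
    hbound (Eventually.of_forall hlim)
  · simpa only [besselK, integral_const_mul, integral_zero] using key
  filter_upwards [self_mem_nhdsWithin] with x hx
  have hx : 0 < x := hx
  filter_upwards [ae_restrict_mem measurableSet_Ioi] with t ht
  have ht : 0 < t := ht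
  have hc := Real.cosh_pos t
  have hcv := Real.cosh_pos (v * t)
  rw [Real.norm_eq_abs, abs_of_pos (by positivity)]
  have he : x * Real.cosh t * Real.exp (-x * Real.cosh t) ≤ 1 := by
    rw [neg_mul, Real.exp_neg, ← div_eq_mul_inv, div_le_one (Real.exp_pos _)]
    linarith [Real.add_one_le_exp (x * Real.cosh t)]
  have hcosh : Real.exp t ≤ 2 * Real.cosh t := by
    rw [Real.cosh_eq]
    linarith [Real.exp_pos (-t)]
  have hv : Real.cosh (v * t) ≤ Real.exp (v * t) := by
    simpa [abs_of_pos (mul_pos h0 ht)] using cosh_le_exp_abs (v * t)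
  have hxe : x * Real.exp (-x * Real.cosh t) ≤ 2 * Real.exp (-t) := by
    rw [Real.exp_neg t, ← div_eq_mul_inv, le_div_iff₀ (Real.exp_pos t)]
    calc x * Real.exp (-x * Real.cosh t) * Real.exp t
        ≤ x * Real.exp (-x * Real.cosh t) * (2 * Real.cosh t) := by gcongr
      _ ≤ 2 := by linarith
  calc x * (Real.exp (-x * Real.cosh t) * Real.cosh (v * t))
      = x * Real.exp (-x * Real.cosh t) * Real.cosh (v * t) := by ring
    _ ≤ 2 * Real.exp (-t) * Real.exp (v * t) := by gcongr
    _ = 2 * Real.exp ((v - 1) * t) := by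
      rw [mul_assoc, ← Real.exp_add]
      ring_nf

lemma deriv_mul_besselK_add_deriv (v : ℝ) {x : ℝ} (hx : 0 < x) :
    deriv (fun y => y * (besselK v y + deriv (besselK v) y)) x =
      (1 - v + x + v ^ 2 / x) * besselK v x - x * besselK (1 - v) x := by
  have heq : (fun y => y * (besselK v y + deriv (besselK v) y)) =ᶠ[𝓝 x]
      fun y => y * besselK v y - y * besselK (1 - v) y - v * besselK v y := by
    filter_upwards [Ioi_mem_nhds hx] with y hy
    have hy : 0 < y := hy
    rw [(hasDerivAt_besselK v hy).deriv]
    field_simp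
    ring
  have hA := hasDerivAt_besselK v hx
  have hB := hasDerivAt_besselK (1 - v) hx
  rw [sub_sub_cancel] at hB
  have h := (((hasDerivAt_id x).mul hA).sub ((hasDerivAt_id x).mul hB)).sub (hA.const_mul v)
  refine heq.deriv_eq.trans (h.deriv.trans ?_)
  simp only [id]
  field_simp
  ring

theorem stmt_13 (v : ℝ) (hv : v ∈ Ioo (0 : ℝ) 1)
    (K : ℝ → ℝ)
    (hK : ∀ x, K x = ∫ t in Ioi (0 : ℝ), Real.exp (-x * Real.cosh t) * Real.cosh (v * t))
    (F G : ℝ → ℝ)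
    (hF : ∀ x, F x = x * (K x + deriv K x))
    (hG : ∀ x, G x = K x) :
    Tendsto (fun x => deriv F x / deriv G x * G x - F x) (𝓝[>] (0 : ℝ)) (𝓝 0) := by
  obtain ⟨h0, h1⟩ := hv
  obtain rfl : K = besselK v := funext hK
  obtain rfl : G = besselK v := funext hG
  obtain rfl : F = fun x => x * (besselK v x + deriv (besselK v) x) := funext hF
  have hA := tendsto_mul_besselK h0 h1
  have hB : Tendsto (fun x => x * besselK (1 - v) x) (𝓝[>] 0) (𝓝 0) :=
    tendsto_mul_besselK (by linarith) (by linarith)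
  have hx1 : Tendsto (fun x : ℝ => 1 + x) (𝓝[>] 0) (𝓝 (1 + 0)) :=
    (tendsto_const_nhds.add tendsto_id).mono_left nhdsWithin_le_nhds
  have hlim : Tendsto (fun x => (1 + x) * (x * besselK v x) / v + 3 * (x * besselK (1 - v) x))
      (𝓝[>] 0) (𝓝 0) := by
    simpa using ((hx1.mul hA).div_const v).add (hB.const_mul 3)
  refine squeeze_zero_norm' ?_ hlim
  filter_upwards [self_mem_nhdsWithin] with x hx
  have hx : 0 < x := hx
  rw [deriv_mul_besselK_add_deriv v hx, (hasDerivAt_besselK v hx).deriv]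
  have hApos := besselK_pos v hx
  have hBpos := besselK_pos (1 - v) hx
  generalize besselK v x = A at *
  generalize besselK (1 - v) x = B at *
  have hD : 0 < x * B + v * A := by positivity
  have hA' : -B - v / x * A = -((x * B + v * A) / x) := by
    field_simp
    ring
  have hH : ((1 - v + x + v ^ 2 / x) * A - x * B) / (-B - v / x * A) * A -
      x * (A + (-B - v / x * A)) =
      (x * B * (x * B + 2 * v * A) - (1 + x) * x * A ^ 2) / (x * B + v * A) := by
    rw [hA']
    field_simp
    ring
  have hb : 0 < x * B := by positivity
  have hp : 0 < (1 + x) * (x * A) := by positivity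
  have hpv : (1 + x) * (x * A) / v * v = (1 + x) * (x * A) := by field_simp
  have hq : 0 < (1 + x) * (x * A) / v := by positivity
  have hvA : 0 < v * A := by positivity
  rw [hH, Real.norm_eq_abs, abs_div, abs_of_pos hD, div_le_iff₀ hD, abs_le]
  have e : (1 + x) * x * A ^ 2 = (1 + x) * (x * A) / v * (v * A) := by
    field_simp
  rw [e]
  generalize (1 + x) * (x * A) / v = q at *
  constructor <;> nlinarith [mul_pos hb hvA, mul_pos hb hb, mul_pos hq hvA, mul_pos hq hb]
end

section
/- Let v ≥ 0 and let K_v(x) = ∫_0^∞ e^{−x·cosh t}·cosh(vt) dt for x > 0. For r ∈ ℝ, the function x ↦ x^r·e^x·K_v(x) is increasing on (0,∞) if and only if r ≥ max(v, 1/2), and it is decreasing on (0,∞) if and only if r ≤ min(v, 1/2). Moreover, if v > 1/2 and 1/2 < r < v, then there exists x₀ > 0 such that this function is decreasing on (0,x₀) and increasing on (x₀,∞); and if 0 ≤ v < 1/2 and v < r < 1/2, then there exists x₀ > 0 such that it is increasing on (0,x₀) and decreasing on (x₀,∞). -/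
open Real Filter Set MeasureTheory Topology

/-- The integrand of the `k`-th derivative of `K_v`, up to sign. -/
noncomputable def besselKernel (v : ℝ) (k : ℕ) (x t : ℝ) : ℝ :=
  Real.exp (-x * Real.cosh t) * Real.cosh (v * t) * Real.cosh t ^ k

/-- The `k`-th derivative of `K_v`, up to sign. -/
noncomputable def besselMoment (v : ℝ) (k : ℕ) (x : ℝ) : ℝ :=
  ∫ t in Ioi (0 : ℝ), besselKernel v k x t

lemma besselKernel_pos (v : ℝ) (k : ℕ) (x t : ℝ) : 0 < besselKernel v k x t :=
  mul_pos (mul_pos (Real.exp_pos _) (Real.cosh_pos _)) (pow_pos (Real.cosh_pos _) _)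

lemma continuous_besselKernel (v : ℝ) (k : ℕ) (x : ℝ) : Continuous (besselKernel v k x) := by
  unfold besselKernel
  fun_prop

lemma cosh_le_exp_of_nonneg {t : ℝ} (ht : 0 ≤ t) : Real.cosh t ≤ Real.exp t := by
  rw [Real.cosh_eq]
  have : Real.exp (-t) ≤ Real.exp t := Real.exp_le_exp.2 (by linarith)
  linarith

lemma sq_div_four_le_cosh {t : ℝ} (ht : 0 ≤ t) : t ^ 2 / 4 ≤ Real.cosh t := by
  rw [Real.cosh_eq]
  have := Real.quadratic_le_exp_of_nonneg ht
  have := Real.exp_pos (-t)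
  linarith

lemma eventually_besselKernel_le {v : ℝ} (hv : 0 ≤ v) (k : ℕ) {x : ℝ} (hx : 0 < x) :
    ∀ᶠ t in atTop, besselKernel v k x t ≤ Real.exp (-t) := by
  filter_upwards [eventually_ge_atTop (4 * (k + v + 1) / x), eventually_ge_atTop 0] with t ht h0
  rw [div_le_iff₀ hx] at ht
  calc besselKernel v k x t
      ≤ Real.exp (-x * (t ^ 2 / 4)) * Real.exp (v * t) * Real.exp t ^ k := by
        have h1 : -x * Real.cosh t ≤ -x * (t ^ 2 / 4) :=
          mul_le_mul_of_nonpos_left (sq_div_four_le_cosh h0) (by linarith)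
        have h2 := cosh_le_exp_of_nonneg (mul_nonneg hv h0)
        have h3 := cosh_le_exp_of_nonneg h0
        have := Real.cosh_pos t
        have := Real.cosh_pos (v * t)
        unfold besselKernel
        gcongr
    _ = Real.exp (-x * (t ^ 2 / 4) + v * t + k * t) := by
        rw [← Real.exp_nat_mul, ← Real.exp_add, ← Real.exp_add]
    _ ≤ Real.exp (-t) := by
        apply Real.exp_le_exp.2
        nlinarith [mul_le_mul_of_nonneg_right ht h0]

lemma integrableOn_besselKernel {v : ℝ} (hv : 0 ≤ v) (k : ℕ) {x : ℝ} (hx : 0 < x) :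
    IntegrableOn (besselKernel v k x) (Ioi 0) := by
  refine integrable_of_isBigO_exp_neg one_pos (continuous_besselKernel v k x).continuousOn
    (Asymptotics.IsBigO.of_bound 1 ?_)
  filter_upwards [eventually_besselKernel_le hv k hx] with t ht
  rw [Real.norm_of_nonneg (besselKernel_pos v k x t).le, Real.norm_of_nonneg (Real.exp_pos _).le]
  simpa using ht

lemma besselMoment_pos {v : ℝ} (hv : 0 ≤ v) (k : ℕ) {x : ℝ} (hx : 0 < x) :
    0 < besselMoment v k x := by
  refine (setIntegral_pos_iff_support_of_nonneg_ae
    (ae_of_all _ fun t => (besselKernel_pos v k x t).le) (integrableOn_besselKernel hv k hx)).2 ?_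
  have : Function.support (besselKernel v k x) = univ :=
    eq_univ_of_forall fun t => (besselKernel_pos v k x t).ne'
  simp [this]

lemma besselMoment_zero_le_one {v : ℝ} (hv : 0 ≤ v) {x : ℝ} (hx : 0 < x) :
    besselMoment v 0 x ≤ besselMoment v 1 x := by
  refine setIntegral_mono (integrableOn_besselKernel hv 0 hx) (integrableOn_besselKernel hv 1 hx)
    fun t => ?_
  exact mul_le_mul_of_nonneg_left (by simp)
    (mul_pos (Real.exp_pos _) (Real.cosh_pos _)).le

lemma hasDerivAt_besselMoment {v : ℝ} (hv : 0 ≤ v) (k : ℕ) {x : ℝ} (hx : 0 < x) :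
    HasDerivAt (besselMoment v k) (-besselMoment v (k + 1) x) x := by
  have hx2 : 0 < x / 2 := by positivity
  have key := (hasDerivAt_integral_of_dominated_loc_of_deriv_le
    (μ := volume.restrict (Ioi (0 : ℝ))) (F := besselKernel v k)
    (F' := fun y t => -besselKernel v (k + 1) y t) (bound := besselKernel v (k + 1) (x / 2))
    (Ioi_mem_nhds (by linarith : x / 2 < x))
    (Eventually.of_forall fun y => (continuous_besselKernel v k y).aestronglyMeasurable)
    (integrableOn_besselKernel hv k hx)
    (continuous_besselKernel v (k + 1) x).neg.aestronglyMeasurable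
    (ae_of_all _ fun t y hy => ?_) (integrableOn_besselKernel hv (k + 1) hx2)
    (ae_of_all _ fun t y _ => ?_)).2
  · rwa [integral_neg] at key
  · rw [norm_neg, Real.norm_of_nonneg (besselKernel_pos _ _ _ _).le]
    unfold besselKernel
    have := Real.cosh_pos t
    have := Real.cosh_pos (v * t)
    have : x / 2 < y := hy
    gcongr
  · unfold besselKernel
    have h := ((((hasDerivAt_id y).neg.mul_const (Real.cosh t)).exp.mul_const
      (Real.cosh (v * t))).mul_const (Real.cosh t ^ k))
    refine h.congr_deriv ?_
    simp only [Pi.neg_apply, id]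
    ring

/-- The modified Bessel equation, in terms of the moments. -/
lemma besselMoment_two {v : ℝ} (hv : 0 ≤ v) {x : ℝ} (hx : 0 < x) :
    x ^ 2 * besselMoment v 2 x = x * besselMoment v 1 x + (x ^ 2 + v ^ 2) * besselMoment v 0 x := by
  have hI := fun k => integrableOn_besselKernel hv k hx
  have hderiv : ∀ t ∈ Ici (0 : ℝ), HasDerivAt
      (fun t => Real.exp (-x * Real.cosh t) *
        (-x * Real.sinh t * Real.cosh (v * t) - v * Real.sinh (v * t)))
      (x ^ 2 * besselKernel v 2 x t - x * besselKernel v 1 x t -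
        (x ^ 2 + v ^ 2) * besselKernel v 0 x t) t := by
    intro t _
    have hvt : HasDerivAt (fun t => v * t) v t := by simpa using (hasDerivAt_id t).const_mul v
    have h := ((Real.hasDerivAt_cosh t).const_mul (-x)).exp.mul
      ((((Real.hasDerivAt_sinh t).const_mul (-x)).mul hvt.cosh).sub (hvt.sinh.const_mul v))
    refine h.congr_deriv ?_
    simp only [besselKernel, Pi.mul_apply, Pi.sub_apply]
    linear_combination (-x ^ 2 * Real.exp (-x * Real.cosh t) * Real.cosh (v * t)) *
      Real.cosh_sq t
  have hlim : Tendsto (fun t => Real.exp (-x * Real.cosh t) *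
        (-x * Real.sinh t * Real.cosh (v * t) - v * Real.sinh (v * t))) atTop (𝓝 0) := by
    have hexp : Tendsto (fun t : ℝ => (x + v) * Real.exp (-t)) atTop (𝓝 0) := by
      simpa using Real.tendsto_exp_neg_atTop_nhds_zero.const_mul (x + v)
    refine squeeze_zero_norm' ?_ hexp
    filter_upwards [eventually_besselKernel_le hv 1 hx, eventually_ge_atTop 0] with t ht h0
    have hs := Real.sinh_nonneg_iff.2 h0
    have hsv := Real.sinh_nonneg_iff.2 (mul_nonneg hv h0)
    have hc := (Real.sinh_lt_cosh t).le
    have hcv := (Real.sinh_lt_cosh (v * t)).le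
    have h1 := Real.one_le_cosh t
    have h1v := Real.one_le_cosh (v * t)
    have e : Real.exp (-x * Real.cosh t) *
        (-x * Real.sinh t * Real.cosh (v * t) - v * Real.sinh (v * t)) =
        -(Real.exp (-x * Real.cosh t) *
        (x * (Real.sinh t * Real.cosh (v * t)) + v * Real.sinh (v * t))) := by ring
    rw [e, norm_neg, Real.norm_of_nonneg (by positivity)]
    calc _ ≤ Real.exp (-x * Real.cosh t) * (x * (Real.cosh t * Real.cosh (v * t)) +
            v * (Real.cosh t * Real.cosh (v * t))) := by
          gcongr
          nlinarith
      _ = (x + v) * besselKernel v 1 x t := by unfold besselKernel; ring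
      _ ≤ _ := by gcongr
  have hsub : IntegrableOn (fun t => x ^ 2 * besselKernel v 2 x t - x * besselKernel v 1 x t)
      (Ioi 0) := ((hI 2).const_mul _).sub ((hI 1).const_mul _)
  have key := integral_Ioi_of_hasDerivAt_of_tendsto' hderiv
    (hsub.sub ((hI 0).const_mul _)) hlim
  rw [integral_sub hsub ((hI 0).const_mul _),
    integral_sub ((hI 2).const_mul _) ((hI 1).const_mul _), integral_const_mul,
    integral_const_mul, integral_const_mul] at key
  simp only [Real.sinh_zero, mul_zero, zero_mul, sub_zero] at key
  unfold besselMoment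
  linarith

/-- The properties of `u(x) = -x K_v'(x) / K_v(x) - x` that control its monotonicity. -/
structure IsBesselRiccati (v : ℝ) (u : ℝ → ℝ) : Prop where
  nonneg : ∀ x, 0 < x → 0 ≤ u x
  hasDerivAt : ∀ x, 0 < x → HasDerivAt u ((u x ^ 2 - v ^ 2 + x * (2 * u x - 1)) / x) x

lemma isBesselRiccati_besselMoment {v : ℝ} (hv : 0 ≤ v) :
    IsBesselRiccati v (fun x => x * besselMoment v 1 x / besselMoment v 0 x - x) where
  nonneg x hx := by
    have h0 := besselMoment_pos hv 0 hx
    rw [sub_nonneg, le_div_iff₀ h0]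
    exact mul_le_mul_of_nonneg_left (besselMoment_zero_le_one hv hx) hx.le
  hasDerivAt x hx := by
    have h0 := (besselMoment_pos hv 0 hx).ne'
    have h := (((hasDerivAt_id x).mul (hasDerivAt_besselMoment hv 1 hx)).div
      (hasDerivAt_besselMoment hv 0 hx) h0).sub (hasDerivAt_id x)
    refine h.congr_deriv ?_
    have h2 : besselMoment v 2 x =
        (x * besselMoment v 1 x + (x ^ 2 + v ^ 2) * besselMoment v 0 x) / x ^ 2 := by
      rw [← besselMoment_two hv hx]
      field_simp
    simp only [Pi.mul_apply, id, Nat.reduceAdd, zero_add, h2]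
    field_simp
    ring

/-- If `f` grows whenever it exceeds `c`, then it never falls back below a value larger
than `c`. -/
lemma le_of_deriv_nonneg_above {f f' : ℝ → ℝ} {a c : ℝ}
    (hf : ∀ x, a ≤ x → HasDerivAt f (f' x) x) (ha : c < f a)
    (hf' : ∀ x, a ≤ x → c < f x → 0 ≤ f' x) {b : ℝ} (hab : a ≤ b) : f a ≤ f b := by
  by_contra! hb
  obtain ⟨m, hm, hma⟩ := exists_between (max_lt ha hb)
  have hcont : ContinuousOn f (Icc a b) := fun x hx => (hf x hx.1).continuousAt.continuousWithinAt
  have hcpt : IsCompact (Icc a b ∩ f ⁻¹' Iic m) :=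
    isCompact_Icc.of_isClosed_subset (hcont.preimage_isClosed_of_isClosed isClosed_Icc isClosed_Iic)
      inter_subset_left
  obtain ⟨s, ⟨⟨has, hsb⟩, hs⟩, hmin⟩ :=
    hcpt.exists_isLeast ⟨b, ⟨hab, le_rfl⟩, ((le_max_right _ _).trans_lt hm).le⟩
  have hmono : MonotoneOn f (Icc a s) := by
    refine monotoneOn_of_hasDerivWithinAt_nonneg (convex_Icc a s)
      (hcont.mono (Icc_subset_Icc_right hsb)) (f' := f')
      (fun x hx => (hf x (interior_subset hx).1).hasDerivWithinAt) fun x hx => ?_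
    rw [interior_Icc] at hx
    refine hf' x hx.1.le ?_
    by_contra! hcx
    have : s ≤ x := hmin ⟨⟨hx.1.le, hx.2.le.trans hsb⟩, hcx.trans ((le_max_left _ _).trans hm.le)⟩
    exact this.not_gt hx.2
  have h1 := hmono ⟨le_rfl, has⟩ ⟨has, le_rfl⟩ has
  have h2 : f s ≤ m := hs
  linarith

lemma monotoneOn_sub_log {f g : ℝ → ℝ} {s : Set ℝ} {δ : ℝ} (hs : Convex ℝ s)
    (hpos : ∀ x ∈ s, 0 < x) (hf : ∀ x ∈ s, HasDerivAt f (g x / x) x) (hg : ∀ x ∈ s, δ ≤ g x) :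
    MonotoneOn (fun x => f x - δ * Real.log x) s := by
  have hd : ∀ x ∈ s, HasDerivAt (fun x => f x - δ * Real.log x) (g x / x - δ * x⁻¹) x :=
    fun x hx => (hf x hx).sub ((Real.hasDerivAt_log (hpos x hx).ne').const_mul δ)
  refine monotoneOn_of_hasDerivWithinAt_nonneg hs
    (fun x hx => (hd x hx).continuousAt.continuousWithinAt)
    (fun x hx => (hd x (interior_subset hx)).hasDerivWithinAt) fun x hx => ?_
  have hx := interior_subset hx
  rw [← div_eq_mul_inv, ← sub_div]
  exact div_nonneg (sub_nonneg.2 (hg x hx)) (hpos x hx).le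

lemma exists_lt_of_log_growth {f g : ℝ → ℝ} {a δ : ℝ} (ha : 0 < a) (hδ : 0 < δ)
    (hf : ∀ x, a ≤ x → HasDerivAt f (g x / x) x) (hg : ∀ x, a ≤ x → δ ≤ g x) (M : ℝ) :
    ∃ x, a ≤ x ∧ M < f x := by
  have hmono := monotoneOn_sub_log (convex_Ici a) (fun x hx => ha.trans_le hx) hf hg
  have hlim : Tendsto (fun x => δ * Real.log x) atTop atTop :=
    Real.tendsto_log_atTop.const_mul_atTop hδ
  obtain ⟨x, hx, hax⟩ := ((hlim.eventually_gt_atTop (M - (f a - δ * Real.log a))).and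
    (eventually_ge_atTop a)).exists
  have := hmono self_mem_Ici hax hax
  exact ⟨x, hax, by dsimp only at this; linarith⟩

lemma exists_gt_of_log_growth {f g : ℝ → ℝ} {a δ : ℝ} (ha : 0 < a) (hδ : 0 < δ)
    (hf : ∀ x, 0 < x → x ≤ a → HasDerivAt f (g x / x) x) (hg : ∀ x, 0 < x → x ≤ a → δ ≤ g x)
    (M : ℝ) : ∃ x, 0 < x ∧ f x < M := by
  have hmono := monotoneOn_sub_log (convex_Ioc 0 a) (fun x hx => hx.1)
    (fun x hx => hf x hx.1 hx.2) (fun x hx => hg x hx.1 hx.2)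
  have hlim : Tendsto (fun x => δ * Real.log x) (𝓝[>] 0) atBot :=
    Real.tendsto_log_nhdsGT_zero.const_mul_atBot hδ
  obtain ⟨x, hx, hxa⟩ := ((hlim.eventually_lt_atBot (M - (f a - δ * Real.log a))).and
    (Ioc_mem_nhdsGT ha)).exists
  have := hmono hxa ⟨ha, le_rfl⟩ hxa.2
  exact ⟨x, hxa.1, by dsimp only at this; linarith⟩

namespace IsBesselRiccati

variable {v r : ℝ} {u : ℝ → ℝ}

lemma hasDerivAt_neg (h : IsBesselRiccati v u) {x : ℝ} (hx : 0 < x) :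
    HasDerivAt (fun x => -u x) (-(u x ^ 2 - v ^ 2 + x * (2 * u x - 1)) / x) x :=
  (h.hasDerivAt x hx).neg.congr_deriv (neg_div _ _).symm

lemma le_max (h : IsBesselRiccati v u) (hv : 0 ≤ v) {x : ℝ} (hx : 0 < x) :
    u x ≤ max v (1 / 2) := by
  by_contra! hlt
  obtain ⟨hvu, hu⟩ := max_lt_iff.1 hlt
  have hge : ∀ y, x ≤ y → u x ≤ u y := fun y hy =>
    le_of_deriv_nonneg_above (c := max v (1 / 2))
      (fun z hz => h.hasDerivAt z (hx.trans_le hz)) hlt (fun z hz hlz => by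
        obtain ⟨hvz, hz2⟩ := max_lt_iff.1 hlz
        have hz0 := hx.trans_le hz
        have : 0 ≤ z * (2 * u z - 1) := mul_nonneg hz0.le (by linarith)
        exact div_nonneg (by nlinarith) hz0.le) hy
  have hux : 0 < u x := hv.trans_lt hvu
  have hδ : 0 < 1 - v ^ 2 / u x ^ 2 := by
    rw [sub_pos, div_lt_one (by positivity)]
    exact pow_lt_pow_left₀ hvu hv two_ne_zero
  obtain ⟨y, hy, hlt⟩ := exists_lt_of_log_growth (f := fun y => -(u y)⁻¹)
    (g := fun y => (u y ^ 2 - v ^ 2 + y * (2 * u y - 1)) / u y ^ 2) hx hδ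
    (fun y hy => by
      have h0 := (hux.trans_le (hge y hy)).ne'
      refine ((h.hasDerivAt y (hx.trans_le hy)).inv h0).neg.congr_deriv ?_
      field_simp)
    (fun y hy => by
      have hy0 := hx.trans_le hy
      have hxy := hge y hy
      have h0 := hux.trans_le hxy
      have h1 : 0 ≤ y * (2 * u y - 1) := mul_nonneg hy0.le (by linarith)
      have h2 : v ^ 2 / u y ^ 2 ≤ v ^ 2 / u x ^ 2 := by gcongr
      calc 1 - v ^ 2 / u x ^ 2 ≤ 1 - v ^ 2 / u y ^ 2 := by linarith
        _ = (u y ^ 2 - v ^ 2) / u y ^ 2 := by field_simp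
        _ ≤ _ := by gcongr; linarith) 0
  have : 0 < (u y)⁻¹ := inv_pos.2 (hux.trans_le (hge y hy))
  linarith

lemma min_le (h : IsBesselRiccati v u) {x : ℝ} (hx : 0 < x) :
    min v (1 / 2) ≤ u x := by
  by_contra! hlt
  have hD : ∀ z, x ≤ z → u z < min v (1 / 2) →
      u z ^ 2 - v ^ 2 + z * (2 * u z - 1) ≤ x * (2 * u z - 1) := fun z hz hlz => by
    obtain ⟨hvz, hz2⟩ := lt_min_iff.1 hlz
    have := h.nonneg z (hx.trans_le hz)
    nlinarith [mul_nonneg (sub_nonneg.2 hz) (by linarith : 0 ≤ 1 - 2 * u z)]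
  have hge : ∀ y, x ≤ y → u y ≤ u x := fun y hy =>
    neg_le_neg_iff.1 <| le_of_deriv_nonneg_above (c := -min v (1 / 2)) (f := fun y => -u y)
      (fun z hz => h.hasDerivAt_neg (hx.trans_le hz)) (neg_lt_neg hlt) (fun z hz hlz => by
        have hlz := neg_lt_neg_iff.1 hlz
        have := hD z hz hlz
        have : x * (2 * u z - 1) ≤ 0 :=
          mul_nonpos_of_nonneg_of_nonpos hx.le (by linarith [(lt_min_iff.1 hlz).2])
        exact div_nonneg (by linarith) (hx.trans_le hz).le) hy
  obtain ⟨y, hy, hlt'⟩ := exists_lt_of_log_growth (f := fun y => -u y)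
    (δ := x * (1 - 2 * u x)) hx (mul_pos hx (by linarith [(lt_min_iff.1 hlt).2]))
    (fun y hy => h.hasDerivAt_neg (hx.trans_le hy))
    (fun y hy => by
      have := hD y hy ((hge y hy).trans_lt hlt)
      have := mul_le_mul_of_nonneg_left (hge y hy) hx.le
      linarith) 0
  linarith [h.nonneg y (hx.trans_le hy)]

lemma max_le_of_forall_le (h : IsBesselRiccati v u) (hr : ∀ x, 0 < x → u x ≤ r) :
    max v (1 / 2) ≤ r := by
  have hr0 : 0 ≤ r := (h.nonneg 1 one_pos).trans (hr 1 one_pos)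
  have hD : ∀ x, 0 < x →
      u x ^ 2 - v ^ 2 + x * (2 * u x - 1) ≤ r ^ 2 - v ^ 2 + x * (2 * r - 1) := fun x hx => by
    have := h.nonneg x hx
    have := hr x hx
    gcongr
  refine max_le ?_ ?_
  · by_contra! hlt
    have hpos : 0 < v ^ 2 - r ^ 2 := by nlinarith
    have ha : 0 < (v ^ 2 - r ^ 2) / (2 * (2 * r + 1)) := by positivity
    obtain ⟨x, hx, hxr⟩ := exists_gt_of_log_growth (f := fun y => -u y)
      (δ := (v ^ 2 - r ^ 2) / 2) ha (half_pos hpos) (fun y hy _ => h.hasDerivAt_neg hy)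
      (fun y hy hya => by
        have := hD y hy
        rw [le_div_iff₀ (by positivity)] at hya
        nlinarith) (-r)
    linarith [hr x hx]
  · by_contra! hlt
    have hpos : 0 < 1 - 2 * r := by linarith
    have ha : 0 < (r ^ 2 + 1) / (1 - 2 * r) := by positivity
    obtain ⟨x, hx, hxr⟩ := exists_lt_of_log_growth (f := fun y => -u y)
      ha one_pos (fun y hy => h.hasDerivAt_neg (ha.trans_le hy))
      (fun y hy => by
        have := hD y (ha.trans_le hy)
        rw [div_le_iff₀ hpos] at hy
        nlinarith [sq_nonneg v]) 0
    linarith [h.nonneg x (ha.trans_le hx)]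

lemma le_min_of_forall_le (h : IsBesselRiccati v u) (hv : 0 ≤ v) (hr : ∀ x, 0 < x → r ≤ u x) :
    r ≤ min v (1 / 2) := by
  refine _root_.le_min ?_ ?_
  · by_contra! hlt
    have hpos : 0 < r ^ 2 - v ^ 2 := by nlinarith
    obtain ⟨x, hx, hxr⟩ := exists_gt_of_log_growth (δ := (r ^ 2 - v ^ 2) / 2) (half_pos hpos)
      (half_pos hpos) (fun y hy _ => h.hasDerivAt y hy)
      (fun y hy hya => by
        have := hr y hy
        have := mul_nonneg hy.le (h.nonneg y hy)
        nlinarith) 0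
    linarith [h.nonneg x hx]
  · by_contra! hlt
    have hpos : 0 < 2 * r - 1 := by linarith
    have ha : 0 < (v ^ 2 + 1) / (2 * r - 1) := by positivity
    obtain ⟨x, hx, hxr⟩ := exists_lt_of_log_growth
      ha one_pos (fun y hy => h.hasDerivAt y (ha.trans_le hy))
      (fun y hy => by
        have hy0 := ha.trans_le hy
        have := mul_le_mul_of_nonneg_left (hr y hy0) hy0.le
        rw [div_le_iff₀ hpos] at hy
        nlinarith [sq_nonneg (u y)]) (max v (1 / 2))
    exact (h.le_max hv (ha.trans_le hx)).not_gt hxr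

lemma hasDerivAt_numerator (h : IsBesselRiccati v u) {x : ℝ} (hx : 0 < x) :
    HasDerivAt (fun x => u x ^ 2 - v ^ 2 + x * (2 * u x - 1))
      (2 * (u x + x) / x * (u x ^ 2 - v ^ 2 + x * (2 * u x - 1)) + (2 * u x - 1)) x := by
  have hu := h.hasDerivAt x hx
  refine (((hu.pow 2).sub_const (v ^ 2)).add
    ((hasDerivAt_id x).mul ((hu.const_mul 2).sub_const 1))).congr_deriv ?_
  simp only [id]
  field_simp
  ring

lemma numerator_nonpos (h : IsBesselRiccati v u) (hv : 1 / 2 ≤ v) {x : ℝ} (hx : 0 < x) :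
    u x ^ 2 - v ^ 2 + x * (2 * u x - 1) ≤ 0 := by
  by_contra! hlt
  obtain ⟨y, hy, hlt'⟩ := exists_lt_of_log_growth hx hlt
    (fun y hy => h.hasDerivAt y (hx.trans_le hy))
    (fun y hy => le_of_deriv_nonneg_above (c := 0)
      (fun z hz => h.hasDerivAt_numerator (hx.trans_le hz)) hlt (fun z hz hlz => by
        have hz0 := hx.trans_le hz
        have h1 := h.nonneg z hz0
        have h2 := h.min_le hz0
        rw [min_eq_right hv] at h2
        exact add_nonneg (mul_nonneg (by positivity) hlz.le) (by linarith)) hy) (max v (1 / 2))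
  exact (h.le_max (by linarith) (hx.trans_le hy)).not_gt hlt'

lemma numerator_nonneg (h : IsBesselRiccati v u) (hv0 : 0 ≤ v) (hv : v ≤ 1 / 2) {x : ℝ}
    (hx : 0 < x) : 0 ≤ u x ^ 2 - v ^ 2 + x * (2 * u x - 1) := by
  by_contra! hlt
  obtain ⟨y, hy, hlt'⟩ := exists_lt_of_log_growth (f := fun y => -u y) hx (neg_pos.2 hlt)
    (fun y hy => h.hasDerivAt_neg (hx.trans_le hy))
    (fun y hy => le_of_deriv_nonneg_above (c := 0)
      (f := fun x => -(u x ^ 2 - v ^ 2 + x * (2 * u x - 1)))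
      (fun z hz => (h.hasDerivAt_numerator (hx.trans_le hz)).neg) (neg_pos.2 hlt)
      (fun z hz hlz => by
        have hz0 := hx.trans_le hz
        have h1 := h.nonneg z hz0
        have h2 := h.le_max hv0 hz0
        rw [max_eq_right hv] at h2
        have := mul_nonneg (by positivity : 0 ≤ 2 * (u z + z) / z) hlz.le
        linarith) hy) 0
  linarith [h.nonneg y (hx.trans_le hy)]

lemma antitoneOn (h : IsBesselRiccati v u) (hv : 1 / 2 ≤ v) : AntitoneOn u (Ioi 0) :=
  antitoneOn_of_hasDerivWithinAt_nonpos (convex_Ioi 0)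
    (fun x hx => (h.hasDerivAt x hx).continuousAt.continuousWithinAt)
    (fun x hx => (h.hasDerivAt x (interior_subset hx)).hasDerivWithinAt)
    fun _ hx => div_nonpos_of_nonpos_of_nonneg (h.numerator_nonpos hv (interior_subset hx))
      (le_of_lt (interior_subset hx))

lemma monotoneOn (h : IsBesselRiccati v u) (hv0 : 0 ≤ v) (hv : v ≤ 1 / 2) :
    MonotoneOn u (Ioi 0) :=
  monotoneOn_of_hasDerivWithinAt_nonneg (convex_Ioi 0)
    (fun x hx => (h.hasDerivAt x hx).continuousAt.continuousWithinAt)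
    (fun x hx => (h.hasDerivAt x (interior_subset hx)).hasDerivWithinAt)
    fun _ hx => div_nonneg (h.numerator_nonneg hv0 hv (interior_subset hx))
      (le_of_lt (interior_subset hx))

end IsBesselRiccati

lemma exists_crossing_of_antitoneOn {u : ℝ → ℝ} (hu : AntitoneOn u (Ioi 0)) {r p q : ℝ}
    (hp : 0 < p) (hrp : r < u p) (hq : 0 < q) (hqr : u q < r) :
    ∃ x0 > 0, (∀ x ∈ Ioo 0 x0, r ≤ u x) ∧ ∀ x ∈ Ioi x0, u x ≤ r := by
  have hbdd : BddAbove {x | 0 < x ∧ r ≤ u x} :=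
    ⟨q, fun x hx => le_of_not_gt fun hqx => (hx.2.trans (hu hq hx.1 hqx.le)).not_gt hqr⟩
  have hne : {x | 0 < x ∧ r ≤ u x}.Nonempty := ⟨p, hp, hrp.le⟩
  have hx0 : 0 < sSup {x | 0 < x ∧ r ≤ u x} := hp.trans_le (le_csSup hbdd ⟨hp, hrp.le⟩)
  refine ⟨_, hx0, fun x hx => ?_, fun x hx => ?_⟩
  · obtain ⟨y, ⟨hy, hry⟩, hxy⟩ := exists_lt_of_lt_csSup hne hx.2
    exact hry.trans (hu hx.1 hy hxy.le)
  · by_contra! hlt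
    exact (le_csSup hbdd ⟨hx0.trans hx, hlt.le⟩).not_gt hx

lemma hasDerivAt_rpow_mul_exp_mul {K : ℝ → ℝ} {x K' : ℝ} (hx : 0 < x) (hK : HasDerivAt K K' x)
    (hK0 : K x ≠ 0) (r : ℝ) :
    HasDerivAt (fun x => x ^ r * Real.exp x * K x)
      (x ^ (r - 1) * Real.exp x * K x * (r - (-x * K' / K x - x))) x := by
  refine (((Real.hasDerivAt_rpow_const (Or.inl hx.ne')).mul (Real.hasDerivAt_exp x)).mul
    hK).congr_deriv ?_
  have : x ^ r = x ^ (r - 1) * x := by rw [← Real.rpow_add_one hx.ne', sub_add_cancel]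
  simp only [Pi.mul_apply, this]
  field_simp
  ring

theorem stmt_17 (v : ℝ) (hv : 0 ≤ v)
    (K : ℝ → ℝ)
    (hK : ∀ x, K x = ∫ t in Ioi (0 : ℝ), Real.exp (-x * Real.cosh t) * Real.cosh (v * t))
    (r : ℝ) :
    (MonotoneOn (fun x => x ^ r * Real.exp x * K x) (Ioi 0) ↔ max v (1 / 2) ≤ r) ∧
    (AntitoneOn (fun x => x ^ r * Real.exp x * K x) (Ioi 0) ↔ r ≤ min v (1 / 2)) ∧
    (1 / 2 < v → 1 / 2 < r → r < v →
      ∃ x0 > (0 : ℝ), AntitoneOn (fun x => x ^ r * Real.exp x * K x) (Ioo 0 x0) ∧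
        MonotoneOn (fun x => x ^ r * Real.exp x * K x) (Ioi x0)) ∧
    (v < 1 / 2 → v < r → r < 1 / 2 →
      ∃ x0 > (0 : ℝ), MonotoneOn (fun x => x ^ r * Real.exp x * K x) (Ioo 0 x0) ∧
        AntitoneOn (fun x => x ^ r * Real.exp x * K x) (Ioi x0)) := by
  obtain rfl : K = besselMoment v 0 := funext fun x => by simp [hK, besselMoment, besselKernel]
  have hpos := fun x (hx : 0 < x) => besselMoment_pos hv 0 hx
  have hR := isBesselRiccati_besselMoment hv
  set u := fun x => x * besselMoment v 1 x / besselMoment v 0 x - x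
  have hw : ∀ x, 0 < x → 0 < x ^ (r - 1) * Real.exp x * besselMoment v 0 x := fun x hx =>
    mul_pos (mul_pos (Real.rpow_pos_of_pos hx _) (Real.exp_pos x)) (hpos x hx)
  have hF : ∀ x, 0 < x → HasDerivAt (fun x => x ^ r * Real.exp x * besselMoment v 0 x)
      (x ^ (r - 1) * Real.exp x * besselMoment v 0 x * (r - u x)) x := fun x hx => by
    simpa [u] using hasDerivAt_rpow_mul_exp_mul hx (hasDerivAt_besselMoment hv 0 hx)
      (hpos x hx).ne' r
  set F := fun x => x ^ r * Real.exp x * besselMoment v 0 x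
  have hmono : ∀ s ⊆ Ioi (0 : ℝ), Convex ℝ s → (∀ x ∈ s, u x ≤ r) → MonotoneOn F s :=
    fun s hs hc hle => monotoneOn_of_hasDerivWithinAt_nonneg hc
      (fun x hx => (hF x (hs hx)).continuousAt.continuousWithinAt)
      (fun x hx => (hF x (hs (interior_subset hx))).hasDerivWithinAt)
      fun x hx => mul_nonneg (hw x (hs (interior_subset hx))).le
        (sub_nonneg.2 (hle x (interior_subset hx)))
  have hanti : ∀ s ⊆ Ioi (0 : ℝ), Convex ℝ s → (∀ x ∈ s, r ≤ u x) → AntitoneOn F s :=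
    fun s hs hc hle => antitoneOn_of_hasDerivWithinAt_nonpos hc
      (fun x hx => (hF x (hs hx)).continuousAt.continuousWithinAt)
      (fun x hx => (hF x (hs (interior_subset hx))).hasDerivWithinAt)
      fun x hx => mul_nonpos_of_nonneg_of_nonpos (hw x (hs (interior_subset hx))).le
        (sub_nonpos.2 (hle x (interior_subset hx)))
  have hderiv : ∀ x, 0 < x → derivWithin F (Ioi 0) x =
      x ^ (r - 1) * Real.exp x * besselMoment v 0 x * (r - u x) := fun x hx =>
    (hF x hx).hasDerivWithinAt.derivWithin (isOpen_Ioi.uniqueDiffWithinAt hx)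
  refine ⟨⟨fun h => hR.max_le_of_forall_le fun x hx => ?_, fun h => ?_⟩,
    ⟨fun h => hR.le_min_of_forall_le hv fun x hx => ?_, fun h => ?_⟩,
    fun hv2 hr hrv => ?_, fun hv2 hvr hr => ?_⟩
  · have := h.derivWithin_nonneg (x := x)
    rw [hderiv x hx] at this
    exact sub_nonneg.1 (nonneg_of_mul_nonneg_right this (hw x hx))
  · exact hmono _ subset_rfl (convex_Ioi 0) fun x hx => (hR.le_max hv hx).trans h
  · have := h.derivWithin_nonpos (x := x)
    rw [hderiv x hx] at this
    exact sub_nonpos.1 (nonpos_of_mul_nonpos_right this (hw x hx))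
  · exact hanti _ subset_rfl (convex_Ioi 0) fun x hx => h.trans (hR.min_le hx)
  all_goals
    obtain ⟨p, hp, hrp⟩ : ∃ p, 0 < p ∧ r < u p := by
      by_contra! hle
      have := max_le_iff.1 (hR.max_le_of_forall_le hle)
      linarith
    obtain ⟨q, hq, hqr⟩ : ∃ q, 0 < q ∧ u q < r := by
      by_contra! hle
      have := le_min_iff.1 (hR.le_min_of_forall_le hv hle)
      linarith
  · obtain ⟨x0, hx0, h1, h2⟩ :=
      exists_crossing_of_antitoneOn (hR.antitoneOn hv2.le) hp hrp hq hqr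
    exact ⟨x0, hx0, hanti _ (fun x hx => hx.1) (convex_Ioo 0 x0) h1,
      hmono _ (Ioi_subset_Ioi hx0.le) (convex_Ioi x0) h2⟩
  · obtain ⟨x0, hx0, h1, h2⟩ := exists_crossing_of_antitoneOn (hR.monotoneOn hv hv2.le).neg
      hq (neg_lt_neg hqr) hp (neg_lt_neg hrp)
    exact ⟨x0, hx0, hmono _ (fun x hx => hx.1) (convex_Ioo 0 x0)
        fun x hx => neg_le_neg_iff.1 (h1 x hx),
      hanti _ (Ioi_subset_Ioi hx0.le) (convex_Ioi x0) fun x hx => neg_le_neg_iff.1 (h2 x hx)⟩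
end
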